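/- arXiv:2010.09597 — 10 statements merged into one kernel-verified Lean document; each statement's English description precedes it below -/
import Mathlib

section
/- Let f : ℝ^d → ℝ be continuously differentiable and (m,b)-dissipative, and let x* be a global minimizer of f. Then for every x ∈ ℝ^d one has f(x) ≥ (m/4)‖x‖₂² + f(x*) − b/2. -/
open scoped InnerProductSpace

theorem hasDerivAt_comp_smul {E : Type*} [NormedAddCommGroup E] [InnerProductSpace ℝ E]
    [CompleteSpace E] {f : E → ℝ} (hf : Differentiable ℝ f) (x : E) (t : ℝ) :
    HasDerivAt (fun s : ℝ => f (s • x)) ⟪gradient f (t • x), x⟫_ℝ t := by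
  have hsmul : HasDerivAt (fun s : ℝ => s • x) x t := by
    simpa using (hasDerivAt_id t).smul_const x
  have hinner : ⟪gradient f (t • x), x⟫_ℝ = fderiv ℝ f (t • x) x := by simp
  rw [hinner]
  exact (hf (t • x)).hasFDerivAt.comp_hasDerivAt t hsmul

/-- Along every ray, a dissipative function grows at least as fast as
`m / 2 * ‖x‖ ^ 2 * t ^ 2 - b * log t`. -/
theorem monotoneOn_ray_of_dissipative {E : Type*} [NormedAddCommGroup E] [InnerProductSpace ℝ E]
    [CompleteSpace E] {f : E → ℝ} {m b : ℝ} (hf : Differentiable ℝ f)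
    (hdiss : ∀ x : E, m * ‖x‖ ^ 2 - b ≤ ⟪gradient f x, x⟫_ℝ) (x : E) :
    MonotoneOn (fun t : ℝ => f (t • x) - m / 2 * ‖x‖ ^ 2 * t ^ 2 + b * Real.log t)
      (Set.Ioi 0) := by
  have hderiv : ∀ t ∈ Set.Ioi (0 : ℝ), HasDerivAt
      (fun t : ℝ => f (t • x) - m / 2 * ‖x‖ ^ 2 * t ^ 2 + b * Real.log t)
      (⟪gradient f (t • x), x⟫_ℝ - m / 2 * ‖x‖ ^ 2 * (2 * t) + b * t⁻¹) t := by
    intro t ht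
    have hsq : HasDerivAt (fun s : ℝ => s ^ 2) (2 * t) t := by
      simpa using hasDerivAt_pow 2 t
    exact ((hasDerivAt_comp_smul hf x t).sub (hsq.const_mul _)).add
      ((Real.hasDerivAt_log (ne_of_gt ht)).const_mul b)
  refine monotoneOn_of_hasDerivWithinAt_nonneg (convex_Ioi 0)
    (fun t ht => (hderiv t ht).continuousAt.continuousWithinAt)
    (fun t ht => (hderiv t (interior_subset ht)).hasDerivWithinAt) fun t ht => ?_
  have ht0 : 0 < t := interior_subset ht
  have h := hdiss (t • x)
  rw [inner_smul_right, norm_smul, mul_pow, Real.norm_eq_abs, sq_abs] at h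
  refine nonneg_of_mul_nonneg_right (a := t) ?_ ht0
  have hinv : t * (b * t⁻¹) = b := by field_simp
  rw [mul_add, hinv]
  linarith

theorem statement0 {d : ℕ} (f : EuclideanSpace ℝ (Fin d) → ℝ) (m b : ℝ)
    (hm : 0 < m) (hb : 0 ≤ b) (hf : ContDiff ℝ 1 f)
    (hdiss : ∀ x : EuclideanSpace ℝ (Fin d), m * ‖x‖ ^ 2 - b ≤ ⟪gradient f x, x⟫_ℝ)
    (xstar : EuclideanSpace ℝ (Fin d)) (hmin : ∀ y, f xstar ≤ f y)
    (x : EuclideanSpace ℝ (Fin d)) :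
    f x ≥ m / 4 * ‖x‖ ^ 2 + f xstar - b / 2 := by
  have hsq : √(1 / 2 : ℝ) ^ 2 = 1 / 2 := Real.sq_sqrt (by norm_num)
  have hlog : Real.log √(1 / 2 : ℝ) = -Real.log 2 / 2 := by
    rw [Real.log_sqrt (by norm_num), one_div, Real.log_inv]
  have hle : √(1 / 2 : ℝ) ≤ 1 := Real.sqrt_le_one.2 (by norm_num)
  have hmono := monotoneOn_ray_of_dissipative (hf.differentiable one_ne_zero) hdiss x
    (Set.mem_Ioi.2 (Real.sqrt_pos.2 (by norm_num : (0 : ℝ) < 1 / 2)))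
    (Set.mem_Ioi.2 one_pos) hle
  simp only [hsq, hlog, one_smul, Real.log_one] at hmono
  have hlog2 : Real.log 2 ≤ 1 := by linarith [Real.log_two_lt_d9]
  have hblog : b * Real.log 2 ≤ b := mul_le_of_le_one_right hb hlog2
  linarith [hmin (√(1 / 2 : ℝ) • x)]
end

section
/- Fix R ≥ 0, a batch size 1 ≤ B ≤ n, and set M = L·R + G. For every x ∈ ℝ^d with ‖x‖₂ ≤ R and every vector a ∈ ℝ^d, the stochastic gradient g(x,I) obtained from a uniformly random size-B subset I of {1,…,n} satisfies E_I[exp(⟨a, g(x,I) − ∇f(x)⟩)] ≤ exp(M²‖a‖₂²/B). Moreover, if B = n then E_I[exp(⟨a, g(x,I) − ∇f(x)⟩)] = 1. -/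
open scoped InnerProductSpace BigOperators

/-- The mini-batch stochastic gradient `g(x, I) = (1/B) ∑_{i ∈ I} ∇f_i(x)`. -/
noncomputable def stochGrad {d n : ℕ} (fi : Fin n → EuclideanSpace ℝ (Fin d) → ℝ) (B : ℕ)
    (x : EuclideanSpace ℝ (Fin d)) (I : Finset (Fin n)) : EuclideanSpace ℝ (Fin d) :=
  (B : ℝ)⁻¹ • ∑ i ∈ I, gradient (fi i) x

/-- Expectation of `X` over a uniformly random size-`B` subset `I` of `{1,…,n}`. -/
noncomputable def expectSubsets (n B : ℕ) (X : Finset (Fin n) → ℝ) : ℝ :=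
  (∑ I ∈ Finset.univ.filter (fun I : Finset (Fin n) => I.card = B), X I) /
    ((Finset.univ.filter (fun I : Finset (Fin n) => I.card = B)).card : ℝ)

section Maclaurin

variable {ι : Type*} [Fintype ι] [DecidableEq ι]

/-- Averaging over permutations, replacing a repeated factor by a fresh one decreases the sum. -/
lemma sum_perm_prod_insert_le {y : ι → ℝ} (hy : ∀ i, 0 ≤ y i) {I : Finset ι} {k : ι} (hk : k ∉ I)
    (l : ι) :
    ∑ σ : Equiv.Perm ι, ∏ i ∈ insert k I, y (σ i) ≤
      ∑ σ : Equiv.Perm ι, (∏ i ∈ I, y (σ i)) * y (σ l) := by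
  have hswap : ∀ J : Finset ι, k ∉ J → l ∉ J → ∀ σ : Equiv.Perm ι,
      ∏ i ∈ J, y ((σ * Equiv.swap k l) i) = ∏ i ∈ J, y (σ i) := fun J hkJ hlJ σ =>
    Finset.prod_congr rfl fun i hi => by
      rw [Equiv.Perm.mul_apply, Equiv.swap_apply_of_ne_of_ne (ne_of_mem_of_not_mem hi hkJ)
        (ne_of_mem_of_not_mem hi hlJ)]
  by_cases hl : l ∈ I
  · have hkJ : k ∉ I.erase l := fun h => hk (Finset.mem_of_mem_erase h)
    have hlJ : l ∉ I.erase l := Finset.notMem_erase l I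
    have hsq : ∑ σ : Equiv.Perm ι, (∏ i ∈ I.erase l, y (σ i)) * y (σ l) ^ 2 =
        ∑ σ : Equiv.Perm ι, (∏ i ∈ I.erase l, y (σ i)) * y (σ k) ^ 2 := by
      rw [← Equiv.sum_comp (Equiv.mulRight (Equiv.swap k l))]
      refine Finset.sum_congr rfl fun σ _ => ?_
      rw [Equiv.coe_mulRight, hswap _ hkJ hlJ, Equiv.Perm.mul_apply, Equiv.swap_apply_right]
    have hrhs : ∑ σ : Equiv.Perm ι, (∏ i ∈ I, y (σ i)) * y (σ l) =
        ∑ σ : Equiv.Perm ι, (∏ i ∈ I.erase l, y (σ i)) * ((y (σ l) ^ 2 + y (σ k) ^ 2) / 2) := by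
      have h1 : ∑ σ : Equiv.Perm ι, (∏ i ∈ I, y (σ i)) * y (σ l) =
          ∑ σ : Equiv.Perm ι, (∏ i ∈ I.erase l, y (σ i)) * y (σ l) ^ 2 :=
        Finset.sum_congr rfl fun σ _ => by
          rw [← Finset.mul_prod_erase I (fun i => y (σ i)) hl]; ring
      have h2 : ∑ σ : Equiv.Perm ι,
            (∏ i ∈ I.erase l, y (σ i)) * ((y (σ l) ^ 2 + y (σ k) ^ 2) / 2) =
          (∑ σ : Equiv.Perm ι, (∏ i ∈ I.erase l, y (σ i)) * y (σ l) ^ 2 +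
            ∑ σ : Equiv.Perm ι, (∏ i ∈ I.erase l, y (σ i)) * y (σ k) ^ 2) / 2 := by
        rw [← Finset.sum_add_distrib, Finset.sum_div]
        exact Finset.sum_congr rfl fun σ _ => by ring
      rw [h1, h2, ← hsq]; ring
    rw [hrhs]
    refine Finset.sum_le_sum fun σ _ => ?_
    rw [Finset.prod_insert hk, ← Finset.mul_prod_erase I (fun i => y (σ i)) hl]
    have hP : 0 ≤ ∏ i ∈ I.erase l, y (σ i) := Finset.prod_nonneg fun i _ => hy _
    nlinarith [mul_nonneg hP (sq_nonneg (y (σ l) - y (σ k)))]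
  · refine le_of_eq ?_
    rw [← Equiv.sum_comp (Equiv.mulRight (Equiv.swap k l))]
    refine Finset.sum_congr rfl fun σ _ => ?_
    rw [Equiv.coe_mulRight, Finset.prod_insert hk, hswap I hk hl, Equiv.Perm.mul_apply,
      Equiv.swap_apply_left, mul_comm]

lemma sum_perm_prod_mul_card_pow_le {y : ι → ℝ} (hy : ∀ i, 0 ≤ y i) (I : Finset ι) :
    (∑ σ : Equiv.Perm ι, ∏ i ∈ I, y (σ i)) * (Fintype.card ι : ℝ) ^ I.card ≤
      Fintype.card (Equiv.Perm ι) * (∑ i, y i) ^ I.card := by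
  induction I using Finset.induction_on with
  | empty => simp
  | insert k I hk ih =>
    have hstep : (∑ σ : Equiv.Perm ι, ∏ i ∈ insert k I, y (σ i)) * (Fintype.card ι : ℝ) ≤
        (∑ σ : Equiv.Perm ι, ∏ i ∈ I, y (σ i)) * ∑ i, y i := by
      calc _ = ∑ _l : ι, ∑ σ : Equiv.Perm ι, ∏ i ∈ insert k I, y (σ i) := by
            simp [mul_comm]
        _ ≤ ∑ l : ι, ∑ σ : Equiv.Perm ι, (∏ i ∈ I, y (σ i)) * y (σ l) :=
            Finset.sum_le_sum fun l _ => sum_perm_prod_insert_le hy hk l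
        _ = _ := by
            rw [Finset.sum_comm, Finset.sum_mul]
            refine Finset.sum_congr rfl fun σ _ => ?_
            rw [← Finset.mul_sum, Equiv.sum_comp σ y]
    have hS : 0 ≤ ∑ i, y i := Finset.sum_nonneg fun i _ => hy i
    rw [Finset.card_insert_of_notMem hk, pow_succ', pow_succ, ← mul_assoc, ← mul_assoc]
    calc _ ≤ ((∑ σ : Equiv.Perm ι, ∏ i ∈ I, y (σ i)) * ∑ i, y i) *
          (Fintype.card ι : ℝ) ^ I.card := by gcongr
      _ = ((∑ σ : Equiv.Perm ι, ∏ i ∈ I, y (σ i)) * (Fintype.card ι : ℝ) ^ I.card) *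
          ∑ i, y i := by ring
      _ ≤ _ := by gcongr

/-- Maclaurin's inequality between an elementary symmetric mean and the arithmetic mean. -/
lemma sum_prod_filter_card_mul_card_pow_le {y : ι → ℝ} (hy : ∀ i, 0 ≤ y i) (B : ℕ) :
    (∑ I ∈ Finset.univ.filter (fun I : Finset ι => I.card = B), ∏ i ∈ I, y i) *
        (Fintype.card ι : ℝ) ^ B ≤
      (Finset.univ.filter (fun I : Finset ι => I.card = B)).card * (∑ i, y i) ^ B := by
  set F := Finset.univ.filter (fun I : Finset ι => I.card = B) with hF
  have hsymm : ∀ σ : Equiv.Perm ι, ∑ I ∈ F, ∏ i ∈ I, y (σ i) = ∑ I ∈ F, ∏ i ∈ I, y i := fun σ =>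
    Finset.sum_equiv σ.finsetCongr (by simp [hF]) (by simp)
  have hpos : (0 : ℝ) < Fintype.card (Equiv.Perm ι) := by exact_mod_cast Fintype.card_pos
  refine le_of_mul_le_mul_left ?_ hpos
  calc _ = (∑ _σ : Equiv.Perm ι, ∑ I ∈ F, ∏ i ∈ I, y i) * (Fintype.card ι : ℝ) ^ B := by
        rw [Finset.sum_const, nsmul_eq_mul, Finset.card_univ, mul_assoc]
    _ = ∑ I ∈ F, (∑ σ : Equiv.Perm ι, ∏ i ∈ I, y (σ i)) * (Fintype.card ι : ℝ) ^ I.card := by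
        rw [← Finset.sum_congr rfl fun σ _ => hsymm σ, Finset.sum_comm, Finset.sum_mul]
        exact Finset.sum_congr rfl fun I hI => by rw [(Finset.mem_filter.mp hI).2]
    _ ≤ ∑ I ∈ F, Fintype.card (Equiv.Perm ι) * (∑ i, y i) ^ I.card :=
        Finset.sum_le_sum fun I _ => sum_perm_prod_mul_card_pow_le hy I
    _ = ∑ _I ∈ F, Fintype.card (Equiv.Perm ι) * (∑ i, y i) ^ B :=
        Finset.sum_congr rfl fun I hI => by rw [(Finset.mem_filter.mp hI).2]
    _ = _ := by rw [Finset.sum_const, nsmul_eq_mul]; ring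

end Maclaurin

/-- Hoeffding's lemma for the uniform distribution on a finite type. -/
lemma sum_exp_sub_mean_le {ι : Type*} [Fintype ι] [Nonempty ι] {c : ι → ℝ} {K : ℝ}
    (hc : ∀ i, |c i| ≤ K) (t : ℝ) :
    (Fintype.card ι : ℝ)⁻¹ * ∑ i, Real.exp (t * (c i - (Fintype.card ι : ℝ)⁻¹ * ∑ j, c j)) ≤
      Real.exp (K ^ 2 * t ^ 2 / 2) := by
  let _ : MeasurableSpace ι := ⊤
  have hint : ∀ g : ι → ℝ, ∫ i, g i ∂(PMF.uniformOfFintype ι).toMeasure =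
      (Fintype.card ι : ℝ)⁻¹ * ∑ i, g i := fun g => by
    rw [PMF.integral_eq_sum, Finset.mul_sum]
    simp
  have h := (ProbabilityTheory.hasSubgaussianMGF_of_mem_Icc
    (μ := (PMF.uniformOfFintype ι).toMeasure) (X := c) (a := -K) (b := K)
    (measurable_from_top.aemeasurable)
    (Filter.Eventually.of_forall fun i => abs_le.mp (hc i))).mgf_le t
  rw [ProbabilityTheory.mgf, hint, hint] at h
  refine h.trans_eq ?_
  congr 1
  have hK : ((‖K - -K‖₊ / 2 : NNReal) ^ 2 : ℝ) = K ^ 2 := by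
    push_cast
    rw [Real.norm_eq_abs, div_pow, sq_abs]
    ring
  push_cast at hK ⊢
  rw [hK]

/-- Hoeffding's bound on the moment generating function of a sample mean without replacement. -/
lemma expectSubsets_exp_sub_mean_le {n B : ℕ} (hB : 1 ≤ B) (hBn : B ≤ n) {c : Fin n → ℝ} {K : ℝ}
    (hc : ∀ i, |c i| ≤ K) :
    expectSubsets n B
        (fun I => Real.exp ((B : ℝ)⁻¹ * ∑ i ∈ I, c i - (n : ℝ)⁻¹ * ∑ i, c i)) ≤
      Real.exp (K ^ 2 / B / 2) := by
  have hB0 : (B : ℝ) ≠ 0 := by positivity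
  have hn : 0 < n := by omega
  have : Nonempty (Fin n) := ⟨⟨0, hn⟩⟩
  set m := (n : ℝ)⁻¹ * ∑ i, c i with hm
  have hprod : ∀ I ∈ Finset.univ.filter (fun I : Finset (Fin n) => I.card = B),
      Real.exp ((B : ℝ)⁻¹ * ∑ i ∈ I, c i - m) = ∏ i ∈ I, Real.exp ((B : ℝ)⁻¹ * (c i - m)) := by
    intro I hI
    rw [← Real.exp_sum, ← Finset.mul_sum, Finset.sum_sub_distrib, Finset.sum_const,
      (Finset.mem_filter.mp hI).2, nsmul_eq_mul, mul_sub, inv_mul_cancel_left₀ hB0]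
  have hmac := sum_prod_filter_card_mul_card_pow_le
    (fun i => (Real.exp_pos ((B : ℝ)⁻¹ * (c i - m))).le) B
  have hhoef := sum_exp_sub_mean_le hc (B : ℝ)⁻¹
  rw [Fintype.card_fin] at hmac hhoef
  rw [← hm] at hhoef
  have hF : (0 : ℝ) < (Finset.univ.filter (fun I : Finset (Fin n) => I.card = B)).card := by
    obtain ⟨I, -, hI⟩ := Finset.exists_subset_card_eq
      (show B ≤ (Finset.univ : Finset (Fin n)).card by simpa using hBn)
    exact_mod_cast Finset.card_pos.mpr ⟨I, by simp [hI]⟩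
  have hnpos : (0 : ℝ) < (n : ℝ) ^ B := by positivity
  rw [expectSubsets, Finset.sum_congr rfl hprod]
  calc _ ≤ ((n : ℝ)⁻¹ * ∑ i, Real.exp ((B : ℝ)⁻¹ * (c i - m))) ^ B := by
        rw [div_le_iff₀ hF, mul_pow, inv_pow, mul_assoc, ← div_eq_inv_mul, le_div_iff₀ hnpos,
          mul_comm (_ ^ B)]
        exact hmac
    _ ≤ Real.exp (K ^ 2 * (B : ℝ)⁻¹ ^ 2 / 2) ^ B := by gcongr
    _ = _ := by
        rw [← Real.exp_nat_mul]
        congr 1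
        field_simp

lemma gradient_const_mul_sum {E ι : Type*} [NormedAddCommGroup E] [InnerProductSpace ℝ E]
    [CompleteSpace E] [Fintype ι] {f : ι → E → ℝ} {x : E} (hf : ∀ i, DifferentiableAt ℝ (f i) x)
    (r : ℝ) : gradient (fun x => r * ∑ i, f i x) x = r • ∑ i, gradient (f i) x := by
  refine HasGradientAt.gradient ?_
  rw [hasGradientAt_iff_hasFDerivAt, map_smul, map_sum]
  exact (HasFDerivAt.fun_sum fun i _ => (hf i).hasGradientAt.hasFDerivAt).const_mul r

/-- A vector field with Lipschitz constant `L` grows at most linearly; a negative `L` is only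
possible on a trivial space. -/
lemma norm_le_abs_of_lipschitz {E : Type*} [NormedAddCommGroup E] {g : E → E} {L R G : ℝ}
    (hg : ∀ x y, ‖g x - g y‖ ≤ L * ‖x - y‖) (hG : ‖g 0‖ ≤ G) {x : E} (hx : ‖x‖ ≤ R) :
    ‖g x‖ ≤ |L * R + G| := by
  rcases le_or_gt 0 L with hL | hL
  · have h0 := hg x 0
    rw [sub_zero] at h0
    have h1 := norm_le_norm_sub_add (g x) (g 0)
    have h2 := mul_le_mul_of_nonneg_left hx hL
    exact le_trans (by linarith) (le_abs_self _)
  · have hzero : ∀ z : E, ‖z‖ = 0 := fun z => by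
      have h0 := (norm_nonneg _).trans (hg z 0)
      rw [sub_zero] at h0
      nlinarith [norm_nonneg z]
    rw [hzero]
    exact abs_nonneg _

theorem statement1 {d n : ℕ} (hn : 0 < n)
    (fi : Fin n → EuclideanSpace ℝ (Fin d) → ℝ)
    (L G R : ℝ) (B : ℕ) (hB1 : 1 ≤ B) (hBn : B ≤ n)
    (hC1 : ∀ i, ContDiff ℝ 1 (fi i))
    (hLip : ∀ i, ∀ x y : EuclideanSpace ℝ (Fin d),
      ‖gradient (fi i) x - gradient (fi i) y‖ ≤ L * ‖x - y‖)
    (hG : G = Finset.sup' Finset.univ (Finset.univ_nonempty_iff.mpr ⟨⟨0, hn⟩⟩)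
      (fun i => ‖gradient (fi i) (0 : EuclideanSpace ℝ (Fin d))‖))
    (hR : 0 ≤ R)
    (f : EuclideanSpace ℝ (Fin d) → ℝ) (hf : f = fun x => (n : ℝ)⁻¹ * ∑ i, fi i x)
    (M : ℝ) (hM : M = L * R + G)
    (x : EuclideanSpace ℝ (Fin d)) (hx : ‖x‖ ≤ R) (a : EuclideanSpace ℝ (Fin d)) :
    expectSubsets n B (fun I => Real.exp ⟪a, stochGrad fi B x I - gradient f x⟫_ℝ) ≤
        Real.exp (M ^ 2 * ‖a‖ ^ 2 / B) ∧
      (B = n →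
        expectSubsets n B (fun I => Real.exp ⟪a, stochGrad fi B x I - gradient f x⟫_ℝ) = 1) := by
  have hgrad : gradient f x = (n : ℝ)⁻¹ • ∑ i, gradient (fi i) x := by
    rw [hf]
    exact gradient_const_mul_sum (fun i => (hC1 i).differentiable one_ne_zero x) _
  constructor
  · have hc : ∀ i, |⟪a, gradient (fi i) x⟫_ℝ| ≤ |M| * ‖a‖ := fun i => by
      have hGi : ‖gradient (fi i) 0‖ ≤ G := by
        rw [hG]
        exact Finset.le_sup' (fun i => ‖gradient (fi i) 0‖) (Finset.mem_univ i)
      rw [hM, mul_comm]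
      exact (abs_real_inner_le_norm _ _).trans (mul_le_mul_of_nonneg_left
        (norm_le_abs_of_lipschitz (hLip i) hGi hx) (norm_nonneg a))
    have hinner : ∀ I, ⟪a, stochGrad fi B x I - gradient f x⟫_ℝ =
        (B : ℝ)⁻¹ * ∑ i ∈ I, ⟪a, gradient (fi i) x⟫_ℝ -
          (n : ℝ)⁻¹ * ∑ i, ⟪a, gradient (fi i) x⟫_ℝ := fun I => by
      rw [hgrad, stochGrad, inner_sub_right, inner_smul_right, inner_smul_right, inner_sum,
        inner_sum]
    simp_rw [hinner]
    refine (expectSubsets_exp_sub_mean_le hB1 hBn hc).trans (Real.exp_le_exp.mpr ?_)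
    rw [mul_pow, sq_abs]
    exact half_le_self (by positivity)
  · rintro rfl
    have hF : Finset.univ.filter (fun I : Finset (Fin B) => I.card = B) = {Finset.univ} := by
      ext I
      simp [← Finset.card_eq_iff_eq_univ]
    rw [expectSubsets, hF]
    simp [stochGrad, hgrad]
end

section
/- Let η > 0 and β > 0, and for u ∈ ℝ^d let P(·|u) denote the probability measure on ℝ^d obtained as the uniform mixture over all size-B subsets I of {1,…,n} of the Gaussian measures N(u − η g(u,I), (2η/β) I_d). Then for any two points u, v ∈ ℝ^d, the total variation distance satisfies ‖P(·|u) − P(·|v)‖_TV ≤ (1 + Lη)‖u − v‖₂ / √(2η/β). -/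
open MeasureTheory
open scoped InnerProductSpace BigOperators ENNReal

/-- The Gaussian measure `N(μ, σ2 · I_d)` on `ℝ^d`, defined via its density with
respect to the Lebesgue measure. -/
noncomputable def gaussMeasure {d : ℕ} (μ : EuclideanSpace ℝ (Fin d)) (σ2 : ℝ) :
    Measure (EuclideanSpace ℝ (Fin d)) :=
  volume.withDensity fun x =>
    ENNReal.ofReal ((2 * Real.pi * σ2) ^ (-(d : ℝ) / 2) * Real.exp (-‖x - μ‖ ^ 2 / (2 * σ2)))

/-- The one-step SGLD transition measure `P(·|u)`: the uniform mixture over all size-`B`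
subsets `I` of `{1,…,n}` of the Gaussian measures `N(u − η g(u,I), (2η/β) I_d)`. -/
noncomputable def sgldTransition {d n : ℕ} (fi : Fin n → EuclideanSpace ℝ (Fin d) → ℝ)
    (B : ℕ) (η βv : ℝ) (u : EuclideanSpace ℝ (Fin d)) :
    Measure (EuclideanSpace ℝ (Fin d)) :=
  (((Finset.univ.filter (fun I : Finset (Fin n) => I.card = B)).card : ℝ≥0∞))⁻¹ •
    ∑ I ∈ Finset.univ.filter (fun I : Finset (Fin n) => I.card = B),
      gaussMeasure (u - η • stochGrad fi B u I) (2 * η / βv)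

/-- The density of `N(μ, σ2 · I_d)` with respect to the Lebesgue measure. -/
noncomputable def gaussDensity {d : ℕ} (μ : EuclideanSpace ℝ (Fin d)) (σ2 : ℝ)
    (x : EuclideanSpace ℝ (Fin d)) : ℝ :=
  (2 * Real.pi * σ2) ^ (-(d : ℝ) / 2) * Real.exp (-‖x - μ‖ ^ 2 / (2 * σ2))

lemma gaussDensity_nonneg {d : ℕ} (μ : EuclideanSpace ℝ (Fin d)) {σ2 : ℝ} (hσ : 0 < σ2)
    (x : EuclideanSpace ℝ (Fin d)) : 0 ≤ gaussDensity μ σ2 x := by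
  unfold gaussDensity
  positivity

lemma integral_gaussDensity {d : ℕ} (μ : EuclideanSpace ℝ (Fin d)) {σ2 : ℝ} (hσ : 0 < σ2) :
    ∫ x, gaussDensity μ σ2 x = 1 := by
  have h1 : ∫ x, gaussDensity μ σ2 x = ∫ x, gaussDensity (0 : EuclideanSpace ℝ (Fin d)) σ2 x := by
    rw [← integral_sub_right_eq_self (gaussDensity (0 : EuclideanSpace ℝ (Fin d)) σ2) μ]
    simp [gaussDensity]
  have h2 := GaussianFourier.integral_rexp_neg_mul_sq_norm (V := EuclideanSpace ℝ (Fin d))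
    (b := (2 * σ2)⁻¹) (by positivity)
  rw [h1]
  simp only [gaussDensity, sub_zero]
  rw [integral_const_mul]
  have h3 : ∀ x : EuclideanSpace ℝ (Fin d),
      -‖x‖ ^ 2 / (2 * σ2) = -(2 * σ2)⁻¹ * ‖x‖ ^ 2 := fun x => by ring
  simp_rw [h3]
  rw [h2, finrank_euclideanSpace_fin, div_inv_eq_mul,
    show Real.pi * (2 * σ2) = 2 * Real.pi * σ2 by ring, ← Real.rpow_add (by positivity)]
  ring_nf
  exact Real.rpow_zero _

lemma integrable_gaussDensity {d : ℕ} (μ : EuclideanSpace ℝ (Fin d)) {σ2 : ℝ} (hσ : 0 < σ2) :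
    Integrable (gaussDensity μ σ2) :=
  Integrable.of_integral_ne_zero (by rw [integral_gaussDensity μ hσ]; exact one_ne_zero)

lemma gaussMeasure_apply_toReal {d : ℕ} (μ : EuclideanSpace ℝ (Fin d)) {σ2 : ℝ} (hσ : 0 < σ2)
    {A : Set (EuclideanSpace ℝ (Fin d))} (hA : MeasurableSet A) :
    (gaussMeasure μ σ2 A).toReal = ∫ x in A, gaussDensity μ σ2 x := by
  rw [gaussMeasure, withDensity_apply _ hA, integral_eq_lintegral_of_nonneg_ae
    (.of_forall (gaussDensity_nonneg μ hσ))
    (integrable_gaussDensity μ hσ).aestronglyMeasurable.restrict]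
  rfl

lemma gaussMeasure_ne_top {d : ℕ} (μ : EuclideanSpace ℝ (Fin d)) {σ2 : ℝ} (hσ : 0 < σ2)
    (A : Set (EuclideanSpace ℝ (Fin d))) : gaussMeasure μ σ2 A ≠ ∞ := by
  have : IsFiniteMeasure (gaussMeasure μ σ2) :=
    isFiniteMeasure_withDensity_ofReal (integrable_gaussDensity μ hσ).hasFiniteIntegral
  exact measure_ne_top _ _

/-- The geometric mean of two Gaussian densities is a multiple of the Gaussian density centred at
the midpoint of their means. -/
lemma gaussDensity_mul_gaussDensity {d : ℕ} (a b x : EuclideanSpace ℝ (Fin d)) (σ2 : ℝ) :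
    gaussDensity a σ2 x * gaussDensity b σ2 x =
      (Real.exp (-‖a - b‖ ^ 2 / (8 * σ2)) * gaussDensity (midpoint ℝ a b) σ2 x) ^ 2 := by
  have key : ‖x - a‖ ^ 2 + ‖x - b‖ ^ 2 = 2 * ‖x - midpoint ℝ a b‖ ^ 2 + ‖a - b‖ ^ 2 / 2 := by
    have h := parallelogram_law_with_norm ℝ (x - a) (x - b)
    have e1 : (x - a) + (x - b) = (2 : ℝ) • (x - midpoint ℝ a b) := by
      rw [midpoint_eq_smul_add, smul_sub, smul_smul]
      norm_num
      rw [two_smul]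
      abel
    have e2 : (x - a) - (x - b) = b - a := by abel
    rw [e1, e2, norm_smul, norm_sub_rev b a] at h
    norm_num at h
    nlinarith
  have hexp : Real.exp (-‖x - a‖ ^ 2 / (2 * σ2)) * Real.exp (-‖x - b‖ ^ 2 / (2 * σ2)) =
      (Real.exp (-‖a - b‖ ^ 2 / (8 * σ2)) *
        Real.exp (-‖x - midpoint ℝ a b‖ ^ 2 / (2 * σ2))) ^ 2 := by
    rw [← Real.exp_add, ← Real.exp_add, ← Real.exp_nat_mul]
    push_cast
    congr 1
    linear_combination (-1 / (2 * σ2)) * key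
  unfold gaussDensity
  linear_combination ((2 * Real.pi * σ2) ^ (-(d : ℝ) / 2)) ^ 2 * hexp

/-- Weighted AM-GM bound of `|p - q| = |√p - √q| (√p + √q)`, with `r = √(p q)`. -/
lemma abs_sub_le_of_mul_eq_sq {p q r s : ℝ} (hp : 0 ≤ p) (hq : 0 ≤ q) (hr : 0 ≤ r)
    (h : p * q = r ^ 2) (hs : 0 < s) :
    |p - q| ≤ 2 / s * (p + q - 2 * r) + s / 8 * (p + q + 2 * r) := by
  have h1 : 2 * r ≤ p + q :=
    abs_le_of_sq_le_sq' (by nlinarith [sq_nonneg (p - q)]) (by positivity)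
      |>.2
  have h0 : 0 ≤ p + q - 2 * r := by linarith
  refine abs_le_of_sq_le_sq ?_ (by positivity)
  have e : (2 / s * (p + q - 2 * r) + s / 8 * (p + q + 2 * r)) ^ 2 =
      (2 / s * (p + q - 2 * r) - s / 8 * (p + q + 2 * r)) ^ 2 + (p - q) ^ 2 := by
    field_simp
    linear_combination (256 * s ^ 2) * h
  rw [e]
  nlinarith [sq_nonneg (2 / s * (p + q - 2 * r) - s / 8 * (p + q + 2 * r))]

lemma abs_gaussMeasure_sub_le {d : ℕ} (a b : EuclideanSpace ℝ (Fin d)) {σ2 : ℝ} (hσ : 0 < σ2)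
    {A : Set (EuclideanSpace ℝ (Fin d))} (hA : MeasurableSet A) :
    |(gaussMeasure a σ2 A).toReal - (gaussMeasure b σ2 A).toReal| ≤ ‖a - b‖ / √σ2 := by
  rcases eq_or_ne a b with rfl | hab
  · simp
  have hn : 0 < ‖a - b‖ := norm_pos_iff.2 (sub_ne_zero.2 hab)
  set s := ‖a - b‖ / √σ2 with hs_def
  have hs : 0 < s := by positivity
  have hs2 : ‖a - b‖ ^ 2 / (8 * σ2) = s ^ 2 / 8 := by
    rw [hs_def, div_pow, Real.sq_sqrt hσ.le]
    field_simp
  set e := Real.exp (-‖a - b‖ ^ 2 / (8 * σ2)) with he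
  have he1 : 1 - s ^ 2 / 8 ≤ e := by
    rw [he, neg_div, hs2]
    linarith [Real.add_one_le_exp (-(s ^ 2 / 8))]
  have he2 : e ≤ 1 := by
    rw [he, Real.exp_le_one_iff, neg_div, neg_nonpos]
    positivity
  have ia := integrable_gaussDensity a hσ
  have ib := integrable_gaussDensity b hσ
  have im := integrable_gaussDensity (midpoint ℝ a b) hσ
  have iadd : Integrable fun x =>
      (2 / s + s / 8) * gaussDensity a σ2 x + (2 / s + s / 8) * gaussDensity b σ2 x :=
    (ia.const_mul _).add (ib.const_mul _)
  have iab : Integrable fun x => gaussDensity a σ2 x - gaussDensity b σ2 x := ia.sub ib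
  rw [gaussMeasure_apply_toReal a hσ hA, gaussMeasure_apply_toReal b hσ hA,
    ← integral_sub ia.integrableOn ib.integrableOn]
  calc |∫ x in A, (gaussDensity a σ2 x - gaussDensity b σ2 x)|
      ≤ ∫ x in A, |gaussDensity a σ2 x - gaussDensity b σ2 x| := abs_integral_le_integral_abs
    _ ≤ ∫ x, |gaussDensity a σ2 x - gaussDensity b σ2 x| :=
        setIntegral_le_integral iab.abs (.of_forall fun x => abs_nonneg _)
    _ ≤ ∫ x, ((2 / s + s / 8) * gaussDensity a σ2 x + (2 / s + s / 8) * gaussDensity b σ2 x +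
          ((s / 4 - 4 / s) * e) * gaussDensity (midpoint ℝ a b) σ2 x) := by
        refine integral_mono iab.abs (iadd.add (im.const_mul _)) fun x => ?_
        refine (abs_sub_le_of_mul_eq_sq (gaussDensity_nonneg a hσ x) (gaussDensity_nonneg b hσ x)
          (mul_nonneg (Real.exp_nonneg _) (gaussDensity_nonneg (midpoint ℝ a b) hσ x))
          (gaussDensity_mul_gaussDensity a b x σ2) hs).trans_eq ?_
        ring
    _ = 4 / s * (1 - e) + s / 4 * (1 + e) := by
        rw [integral_add iadd (im.const_mul _),
          integral_add (ia.const_mul _) (ib.const_mul _), integral_const_mul, integral_const_mul,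
          integral_const_mul, integral_gaussDensity a hσ, integral_gaussDensity b hσ,
          integral_gaussDensity _ hσ]
        ring
    _ ≤ 4 / s * (s ^ 2 / 8) + s / 4 * (1 + 1) := by
        gcongr
        linarith
    _ = s := by
        field_simp
        ring

lemma norm_stochGrad_sub_le {d n : ℕ} (fi : Fin n → EuclideanSpace ℝ (Fin d) → ℝ) {B : ℕ}
    (hB : B ≠ 0) {u v : EuclideanSpace ℝ (Fin d)} {K : ℝ}
    (hK : ∀ i, ‖gradient (fi i) u - gradient (fi i) v‖ ≤ K)
    {I : Finset (Fin n)} (hI : I.card = B) :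
    ‖stochGrad fi B u I - stochGrad fi B v I‖ ≤ K := by
  rw [stochGrad, stochGrad, ← smul_sub, ← Finset.sum_sub_distrib, norm_smul, norm_inv,
    Real.norm_natCast, inv_mul_le_iff₀ (by positivity)]
  refine (norm_sum_le_of_le I fun i _ => hK i).trans_eq ?_
  rw [Finset.sum_const, hI, nsmul_eq_mul]

theorem statement2 {d n : ℕ} (fi : Fin n → EuclideanSpace ℝ (Fin d) → ℝ)
    (L : ℝ) (B : ℕ) (hB1 : 1 ≤ B) (hBn : B ≤ n)
    (hC1 : ∀ i, ContDiff ℝ 1 (fi i))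
    (hLip : ∀ i, ∀ x y : EuclideanSpace ℝ (Fin d),
      ‖gradient (fi i) x - gradient (fi i) y‖ ≤ L * ‖x - y‖)
    (η βv : ℝ) (hη : 0 < η) (hβ : 0 < βv)
    (u v : EuclideanSpace ℝ (Fin d)) :
    ∀ A : Set (EuclideanSpace ℝ (Fin d)), MeasurableSet A →
      |(sgldTransition fi B η βv u A).toReal - (sgldTransition fi B η βv v A).toReal| ≤
        (1 + L * η) * ‖u - v‖ / Real.sqrt (2 * η / βv) := by
  intro A hA
  have hσ : 0 < 2 * η / βv := by positivity
  set S := Finset.univ.filter (fun I : Finset (Fin n) => I.card = B) with hS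
  have hcard : 0 < S.card := by
    obtain ⟨I, -, hI⟩ := Finset.exists_subset_card_eq (s := (Finset.univ : Finset (Fin n)))
      (n := B) (by simpa using hBn)
    exact Finset.card_pos.2 ⟨I, by simp [hS, hI]⟩
  have happ : ∀ w, (sgldTransition fi B η βv w A).toReal = (S.card : ℝ)⁻¹ *
      ∑ I ∈ S, (gaussMeasure (w - η • stochGrad fi B w I) (2 * η / βv) A).toReal := by
    intro w
    simp only [sgldTransition, Measure.smul_apply, Measure.finsetSum_apply, smul_eq_mul,
      ENNReal.toReal_mul, ENNReal.toReal_inv, ENNReal.toReal_natCast]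
    rw [ENNReal.toReal_sum fun I _ => gaussMeasure_ne_top _ hσ A]
  rw [happ, happ, ← mul_sub, ← Finset.sum_sub_distrib, abs_mul, abs_inv, Nat.abs_cast,
    inv_mul_le_iff₀ (by positivity), ← nsmul_eq_mul, ← Finset.sum_const]
  refine (Finset.abs_sum_le_sum_abs _ _).trans (Finset.sum_le_sum fun I hI => ?_)
  refine (abs_gaussMeasure_sub_le _ _ hσ hA).trans ?_
  gcongr
  have hg := norm_stochGrad_sub_le fi (by omega) (fun i => hLip i u v) (Finset.mem_filter.1 hI).2
  calc ‖(u - η • stochGrad fi B u I) - (v - η • stochGrad fi B v I)‖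
      = ‖(u - v) - η • (stochGrad fi B u I - stochGrad fi B v I)‖ := by
        rw [smul_sub]
        congr 1
        abel
    _ ≤ ‖u - v‖ + η * ‖stochGrad fi B u I - stochGrad fi B v I‖ := by
        refine (norm_sub_le _ _).trans_eq ?_
        rw [norm_smul, Real.norm_of_nonneg hη.le]
    _ ≤ ‖u - v‖ + η * (L * ‖u - v‖) := by gcongr
    _ = (1 + L * η) * ‖u - v‖ := by ring
end

section
/- Let R > 0, L, G ≥ 0, η > 0, β > 0, set r = √(10ηd/β), and assume r ≤ R, η ≤ 0.1 d / (β(LR+G)²), and √(β/(2η)) · (r²/R + η(LR+G)) ≤ 0.025. Then for every u ∈ ℝ^d with ‖u‖₂ ≤ R and every vector g ∈ ℝ^d with ‖g‖₂ ≤ LR + G, the Gaussian measure N(u − ηg, (2η/β) I_d) assigns probability at least 0.4 to the set B(0,R) ∩ B(u,r). -/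
open MeasureTheory

open ProbabilityTheory Complex in
/-- The Gaussian density measure is the law of `μ + √σ2 • Z` with `Z` standard Gaussian. -/
lemma gaussMeasure_eq_map_stdGaussian {d : ℕ} (μ : EuclideanSpace ℝ (Fin d)) {σ2 : ℝ}
    (hσ2 : 0 < σ2) :
    gaussMeasure μ σ2 =
      (stdGaussian (EuclideanSpace ℝ (Fin d))).map (fun z => Real.sqrt σ2 • z + μ) := by
  let E := EuclideanSpace ℝ (Fin d)
  set c : ℝ := (2 * Real.pi * σ2) ^ (-(d : ℝ) / 2) with hc
  have hc0 : 0 < c := by positivity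
  have hb : 0 < ((1 / (2 * σ2) : ℝ) : ℂ).re := by rw [ofReal_re]; positivity
  have hint : Integrable fun x : E => c * Real.exp (-‖x - μ‖ ^ 2 / (2 * σ2)) := by
    have h := (GaussianFourier.integrable_cexp_neg_mul_sq_norm_add hb 0 (0 : E)).norm
    refine Integrable.const_mul ?_ c
    have h2 := h.comp_sub_right μ
    refine h2.congr (Filter.Eventually.of_forall fun x => ?_)
    simp only [zero_mul, add_zero, norm_exp]
    congr 1
    rw [← ofReal_neg, ← ofReal_pow, ← ofReal_mul, ofReal_re]
    ring
  have : IsFiniteMeasure (gaussMeasure μ σ2) := by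
    rw [gaussMeasure]
    exact isFiniteMeasure_withDensity_ofReal hint.2
  have : IsProbabilityMeasure
      ((stdGaussian E).map (fun z => Real.sqrt σ2 • z + μ)) :=
    Measure.isProbabilityMeasure_map (by fun_prop)
  apply Measure.ext_of_charFun
  ext t
  have h1 : (fun z : E => Real.sqrt σ2 • z + μ) = (· + μ) ∘ (Real.sqrt σ2 • ·) := rfl
  rw [h1, ← Measure.map_map (by fun_prop) (by fun_prop), charFun_map_add_const, charFun_map_smul,
    charFun_stdGaussian, charFun_apply, gaussMeasure,
    integral_withDensity_eq_integral_toReal_smul (by fun_prop) (by simp)]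
  have h2 : ∀ x : E, (ENNReal.ofReal (c * Real.exp (-‖x - μ‖ ^ 2 / (2 * σ2)))).toReal •
      cexp (inner ℝ x t * I) = (fun y : E => (c * cexp (inner ℝ μ t * I)) *
        cexp (-((1 / (2 * σ2) : ℝ) : ℂ) * ‖y‖ ^ 2 + I * inner ℝ t y)) (x - μ) := by
    intro x
    rw [ENNReal.toReal_ofReal (by positivity), real_smul]
    push_cast
    rw [mul_assoc, mul_assoc, ← exp_add, ← exp_add]
    congr 2
    rw [inner_sub_right, real_inner_comm x t, real_inner_comm μ t]
    push_cast
    ring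
  simp_rw [← hc]
  rw [integral_congr_ae (Filter.Eventually.of_forall h2),
    integral_sub_right_eq_self (μ := (volume : Measure E)) (fun y : E =>
      (c * cexp (inner ℝ μ t * I)) * cexp (-((1 / (2 * σ2) : ℝ) : ℂ) * ‖y‖ ^ 2 + I * inner ℝ t y)) μ,
    integral_const_mul,
    GaussianFourier.integral_cexp_neg_mul_sq_norm_add hb]
  have h3 : ((Real.pi : ℂ) / ((1 / (2 * σ2) : ℝ) : ℂ)) ^ (Module.finrank ℝ E / 2 : ℂ)
      = ((c⁻¹ : ℝ) : ℂ) := by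
    rw [hc, ← Real.rpow_neg (by positivity), ofReal_cpow (by positivity)]
    simp only [one_div, mul_inv_rev, finrank_euclideanSpace, Fintype.card_fin, ofReal_mul,
      ofReal_inv, ofReal_ofNat, ofReal_div, ofReal_neg, ofReal_natCast, E]
    congr 1
    · field_simp
    · ring
  rw [h3]
  have hcc : (c : ℂ) ≠ 0 := by exact_mod_cast hc0.ne'
  have h4 : (I ^ 2 * ‖t‖ ^ 2 / (4 * ((1 / (2 * σ2) : ℝ) : ℂ)) : ℂ)
      = -((‖Real.sqrt σ2 • t‖ : ℝ) : ℂ) ^ 2 / 2 := by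
    rw [← ofReal_pow ‖Real.sqrt σ2 • t‖, norm_smul, mul_pow, Real.norm_eq_abs, sq_abs,
      Real.sq_sqrt hσ2.le, I_sq]
    have : (σ2 : ℂ) ≠ 0 := by exact_mod_cast hσ2.ne'
    push_cast
    field_simp
    ring
  rw [h4]
  push_cast
  field_simp

open ProbabilityTheory in
lemma integral_pow_four_gaussianReal : ∫ x, x ^ 4 ∂(gaussianReal 0 1) = 3 := by
  have h := iteratedDeriv_mgf_zero (X := fun x : ℝ => x) (μ := gaussianReal 0 1) (by simp) 4
  have key : ∀ p p' : ℝ → ℝ, (∀ t, HasDerivAt p (p' t) t) →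
      deriv (fun t => p t * Real.exp (t ^ 2 / 2)) =
        fun t => (p' t + t * p t) * Real.exp (t ^ 2 / 2) := by
    intro p p' hp
    ext t
    have h1 : HasDerivAt (fun t : ℝ => t ^ 2 / 2) t t := by
      have := (hasDerivAt_pow 2 t).div_const 2
      simpa using this
    have := ((hp t).mul h1.exp).deriv
    rw [show (fun t => p t * Real.exp (t ^ 2 / 2)) = p * (fun t => Real.exp (t ^ 2 / 2)) from rfl,
      this]
    ring
  have hmgf : mgf (fun x : ℝ => x) (gaussianReal 0 1) =
      fun t => (1 : ℝ) * Real.exp (t ^ 2 / 2) := by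
    rw [mgf_fun_id_gaussianReal]; simp
  rw [hmgf] at h
  simp only [iteratedDeriv_succ, iteratedDeriv_zero] at h
  rw [key (fun _ => 1) (fun _ => 0) (fun t => hasDerivAt_const t 1),
    key _ (fun _ => 1) (fun t => by simpa using hasDerivAt_id' t),
    key _ (fun t => 2 * t) (fun t => by
      convert! ((hasDerivAt_id' t).mul ((hasDerivAt_const t (0 : ℝ)).add
        ((hasDerivAt_id' t).mul (hasDerivAt_const t (1 : ℝ))))).const_add 1 using 1
      simp; ring),
    key _ (fun t => 3 * t ^ 2 + 3) (fun t => by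
      have h3 := (hasDerivAt_pow 3 t).add ((hasDerivAt_id' t).const_mul 3)
      convert! h3 using 1
      · ext s; simp; ring
      · simp)] at h
  simp at h
  rw [← h]

open ProbabilityTheory in
/-- Fourth-moment Markov bound on the norm of a standard Gaussian vector. -/
lemma stdGaussian_real_lt_norm_le {d : ℕ} {ρ : ℝ} (hρ : 0 < ρ) :
    (stdGaussian (EuclideanSpace ℝ (Fin d))).real {z | ρ < ‖z‖} ≤ 3 * d ^ 2 / ρ ^ 4 := by
  have hx4 : Integrable (fun x : ℝ => x ^ 4) (gaussianReal 0 1) := by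
    have h := (memLp_id_gaussianReal (μ := 0) (v := 1) 4).integrable_norm_pow (by norm_num)
    refine h.congr (Filter.Eventually.of_forall fun x => ?_)
    simp [Even.pow_abs (by decide : Even 4)]
  rw [← map_pi_eq_stdGaussian, map_measureReal_apply (by fun_prop)
    (measurableSet_lt measurable_const measurable_norm)]
  set P := Measure.pi (fun _ : Fin d => gaussianReal 0 1)
  have hi : ∀ i : Fin d, Integrable (fun x : Fin d → ℝ => x i ^ 4) P := fun i =>
    integrable_comp_eval (μ := fun _ : Fin d => gaussianReal 0 1) (i := i) hx4
  have hint : Integrable (fun x : Fin d → ℝ => d * ∑ i, x i ^ 4) P :=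
    (integrable_finsetSum _ fun i _ => hi i).const_mul _
  have hval : ∫ x, d * ∑ i, x i ^ 4 ∂P = 3 * d ^ 2 := by
    rw [integral_const_mul, integral_finsetSum _ fun i _ => hi i]
    have : ∀ i : Fin d, ∫ x, x i ^ 4 ∂P = 3 := fun i => by
      rw [integral_comp_eval (μ := fun _ : Fin d => gaussianReal 0 1) (i := i)
        (f := fun x : ℝ => x ^ 4) hx4.aestronglyMeasurable, integral_pow_four_gaussianReal]
    simp [this]; ring
  have hm := mul_meas_ge_le_integral_of_nonneg (μ := P)
    (f := fun x : Fin d → ℝ => d * ∑ i, x i ^ 4)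
    (Filter.Eventually.of_forall fun x => by
      exact mul_nonneg (by positivity) (Finset.sum_nonneg fun i _ => by positivity)) hint (ρ ^ 4)
  rw [hval] at hm
  rw [le_div_iff₀ (by positivity), mul_comm]
  refine le_trans (mul_le_mul_of_nonneg_left (measureReal_mono fun x hx => ?_) (by positivity)) hm
  simp only [Set.mem_preimage, Set.mem_ofPred_eq] at hx ⊢
  have h1 : ρ ^ 4 ≤ ‖WithLp.toLp 2 x‖ ^ 4 := by gcongr
  refine h1.trans ?_
  have h2 := sq_sum_le_card_mul_sum_sq (s := (Finset.univ : Finset (Fin d)))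
    (f := fun i => x i ^ 2)
  rw [show (4 : ℕ) = 2 * 2 from rfl, pow_mul, EuclideanSpace.real_norm_sq_eq]
  simpa [← pow_mul] using h2

open ProbabilityTheory in
lemma stdGaussian_map_inner {E : Type*} [NormedAddCommGroup E] [InnerProductSpace ℝ E]
    [FiniteDimensional ℝ E] [MeasurableSpace E] [BorelSpace E] {e : E} (he : ‖e‖ = 1) :
    (stdGaussian E).map (fun z => inner ℝ e z) = gaussianReal 0 1 := by
  have h0 : (fun z => inner ℝ e z) = ⇑(innerSL ℝ e) := rfl
  rw [h0]
  have : IsProbabilityMeasure ((stdGaussian E).map (innerSL ℝ e)) :=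
    Measure.isProbabilityMeasure_map (by fun_prop)
  apply Measure.ext_of_charFun
  ext u
  rw [charFun_map_eq_charFunDual_smul, charFunDual_stdGaussian, charFun_gaussianReal, norm_smul,
    innerSL_apply_norm, he, mul_one, ← Complex.ofReal_pow, Real.norm_eq_abs, sq_abs]
  congr 1
  push_cast
  simp
  ring

open ProbabilityTheory in
lemma gaussianReal_real_Ioo_le {δ : ℝ} (hδ : 0 ≤ δ) :
    (gaussianReal 0 1).real (Set.Ioo (-δ) δ) ≤ 0.8 * δ := by
  have hpdf : ∀ x, gaussianPDF 0 1 x ≤ ENNReal.ofReal 0.4 := fun x => by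
    rw [gaussianPDF]
    apply ENNReal.ofReal_le_ofReal
    rw [gaussianPDFReal]
    have h1 : Real.exp (-(x - 0) ^ 2 / (2 * (1 : NNReal))) ≤ 1 := by
      apply Real.exp_le_one_iff.mpr
      rw [neg_div]
      exact neg_nonpos.mpr (by positivity)
    have h2 : (2.5 : ℝ) ≤ √(2 * Real.pi * (1 : NNReal)) := by
      apply Real.le_sqrt_of_sq_le
      have := Real.pi_gt_d2
      simp; linarith
    calc _ ≤ (2.5 : ℝ)⁻¹ * 1 := by gcongr
      _ = 0.4 := by norm_num
  rw [measureReal_def, gaussianReal_apply 0 one_ne_zero]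
  apply ENNReal.toReal_le_of_le_ofReal (by positivity)
  calc ∫⁻ x in Set.Ioo (-δ) δ, gaussianPDF 0 1 x
      ≤ ∫⁻ x in Set.Ioo (-δ) δ, ENNReal.ofReal 0.4 := lintegral_mono fun x => hpdf x
    _ = ENNReal.ofReal (0.8 * δ) := by
      rw [setLIntegral_const, Real.volume_Ioo, ← ENNReal.ofReal_mul (by norm_num)]
      congr 1; ring

open ProbabilityTheory in
/-- A standard Gaussian vector lies in a symmetric cap, cut off at distance `δ` from the central
hyperplane, with probability almost one half. -/
lemma stdGaussian_real_norm_le_inter_inner_le {d : ℕ} {e : EuclideanSpace ℝ (Fin d)}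
    (he : ‖e‖ = 1) {ρ δ : ℝ} (hρ : 0 < ρ) (hδ : 0 ≤ δ) :
    1 - 3 * d ^ 2 / ρ ^ 4 - 0.8 * δ ≤ 2 * (stdGaussian (EuclideanSpace ℝ (Fin d))).real
      {z | ‖z‖ ≤ ρ ∧ inner ℝ e z ≤ -δ} := by
  let E := EuclideanSpace ℝ (Fin d)
  let P : Measure E := stdGaussian E
  have hsymm : P.real {z | ‖z‖ ≤ ρ ∧ δ ≤ inner ℝ e z} =
      P.real {z | ‖z‖ ≤ ρ ∧ inner ℝ e z ≤ -δ} := by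
    have hm : MeasurableSet {z : E | ‖z‖ ≤ ρ ∧ inner ℝ e z ≤ -δ} :=
      (((isClosed_le (by fun_prop) (by fun_prop)).inter
        (isClosed_le (by fun_prop) (by fun_prop))).measurableSet :
        MeasurableSet ({z : E | ‖z‖ ≤ ρ} ∩ {z : E | inner ℝ e z ≤ -δ}))
    conv_rhs => rw [show P = stdGaussian E from rfl, ← stdGaussian_map (LinearIsometryEquiv.neg ℝ (E := E)),
      map_measureReal_apply (by fun_prop) hm]
    congr 1
    ext z
    simp
  have hstrip : P.real {z | inner ℝ e z ∈ Set.Ioo (-δ) δ} ≤ 0.8 * δ := by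
    have := gaussianReal_real_Ioo_le hδ
    rwa [← stdGaussian_map_inner he, map_measureReal_apply (by fun_prop) measurableSet_Ioo] at this
  have htail := stdGaussian_real_lt_norm_le (d := d) hρ
  have hcover : (Set.univ : Set E) ⊆ ({z | ρ < ‖z‖} ∪ {z | inner ℝ e z ∈ Set.Ioo (-δ) δ}) ∪
      ({z | ‖z‖ ≤ ρ ∧ inner ℝ e z ≤ -δ} ∪ {z | ‖z‖ ≤ ρ ∧ δ ≤ inner ℝ e z}) := by
    intro z _
    simp only [Set.mem_union, Set.mem_ofPred_eq, Set.mem_Ioo]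
    grind
  have h1 : P.real Set.univ ≤ _ := measureReal_mono hcover
  rw [probReal_univ] at h1
  have h2 := h1.trans (measureReal_union_le _ _)
  have h3 := measureReal_union_le (μ := P) {z | ρ < ‖z‖} {z | inner ℝ e z ∈ Set.Ioo (-δ) δ}
  have h4 := measureReal_union_le (μ := P) {z | ‖z‖ ≤ ρ ∧ inner ℝ e z ≤ -δ}
    {z | ‖z‖ ≤ ρ ∧ δ ≤ inner ℝ e z}
  linarith

/-- If `u` lies in the ball of radius `R`, then a step from `u` by `σ • z - η • g` stays in that
ball when `z` is not too long and points inwards. -/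
lemma norm_add_sub_le_of_inner_le {E : Type*} [NormedAddCommGroup E] [InnerProductSpace ℝ E]
    {u e g z : E} {R D η σ s r : ℝ} (hR : 0 < R) (hη : 0 < η) (hσ0 : 0 < σ) (hs_two : 2 ≤ s)
    (hrs : r = s * σ) (hsmall : r ^ 2 / R + η * D ≤ 1 / 40 * σ) (hu : ‖u‖ ≤ R) (hg : ‖g‖ ≤ D)
    (heu : R / 2 ≤ ‖u‖ → u = ‖u‖ • e) (hz1 : ‖z‖ ≤ s - 1 / 40)
    (hz2 : inner ℝ e z ≤ -(1 / 40)) :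
    ‖u + (σ • z - η • g)‖ ≤ R ∧ ‖σ • z - η • g‖ ≤ r := by
  have hr0 : 0 ≤ r := by rw [hrs]; positivity
  have hD : 0 ≤ D := (norm_nonneg g).trans hg
  have hηD : 0 ≤ η * D := by positivity
  have hrR0 : 0 ≤ r ^ 2 / R := by positivity
  set w := σ • z - η • g with hw
  have hηg : ‖η • g‖ ≤ η * D := by
    rw [norm_smul, Real.norm_of_nonneg hη.le]; gcongr
  have hwr : ‖w‖ ≤ r := by
    have h1 : ‖σ • z‖ ≤ σ * (s - 1 / 40) := by
      rw [norm_smul, Real.norm_of_nonneg hσ0.le]; gcongr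
    have h2 := norm_sub_le (σ • z) (η • g)
    rw [hrs]
    have : σ * (s - 1 / 40) = s * σ - 1 / 40 * σ := by ring
    linarith
  refine ⟨?_, hwr⟩
  by_cases hcase : R / 2 ≤ ‖u‖
  · have hug : -(‖u‖ * D) ≤ inner ℝ u g := by
      have := neg_le_of_abs_le (abs_real_inner_le_norm u g)
      nlinarith [norm_nonneg u]
    have huz : inner ℝ u z ≤ ‖u‖ * (-(1 / 40)) := by
      rw [heu hcase, real_inner_smul_left, ← heu hcase]
      exact mul_le_mul_of_nonneg_left hz2 (norm_nonneg u)
    have huw : inner ℝ u w ≤ -(r ^ 2 / 2) := by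
      rw [hw, inner_sub_right, real_inner_smul_right, real_inner_smul_right]
      have h1 : r ^ 2 / 2 ≤ ‖u‖ * (r ^ 2 / R) := by
        calc r ^ 2 / 2 = R / 2 * (r ^ 2 / R) := by field_simp
          _ ≤ _ := by gcongr
      have h2 := mul_le_mul_of_nonneg_left huz hσ0.le
      have h3 := mul_le_mul_of_nonneg_left hug hη.le
      have h4 := mul_le_mul_of_nonneg_left hsmall (norm_nonneg u)
      linarith
    have hsq := norm_add_sq_real u w
    have hw2 : ‖w‖ ^ 2 ≤ r ^ 2 := by gcongr
    have hu2 : ‖u‖ ^ 2 ≤ R ^ 2 := by gcongr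
    exact abs_le_of_sq_le_sq' (by linarith) hR.le |>.2
  · have hr2 : r ≤ R / 2 := by
      have h1 : r ^ 2 / R ≤ 1 / 40 * σ := by linarith
      rw [div_le_iff₀ hR] at h1
      have h2 : r * (s * σ) ≤ 1 / 40 * σ * R := by rw [← hrs, ← sq]; exact h1
      have h3 : r * s ≤ 1 / 40 * R := le_of_mul_le_mul_right (by linarith) hσ0
      have h4 := mul_le_mul_of_nonneg_left hs_two hr0
      linarith
    have := norm_add_le u w
    linarith

theorem statement3 {d : ℕ} (R L G η βv r : ℝ) (hR : 0 < R) (hL : 0 ≤ L) (hG : 0 ≤ G)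
    (hη : 0 < η) (hβ : 0 < βv)
    (hr : r = Real.sqrt (10 * η * d / βv)) (hrR : r ≤ R)
    (hη2 : η ≤ 0.1 * d / (βv * (L * R + G) ^ 2))
    (hsmall : Real.sqrt (βv / (2 * η)) * (r ^ 2 / R + η * (L * R + G)) ≤ 0.025)
    (u : EuclideanSpace ℝ (Fin d)) (hu : ‖u‖ ≤ R)
    (g : EuclideanSpace ℝ (Fin d)) (hg : ‖g‖ ≤ L * R + G) :
    ENNReal.ofReal 0.4 ≤
      gaussMeasure (u - η • g) (2 * η / βv)
        (Metric.closedBall (0 : EuclideanSpace ℝ (Fin d)) R ∩ Metric.closedBall u r) := by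
  have hd : 0 < d := by
    rcases Nat.eq_zero_or_pos d with rfl | h
    · simp at hη2; linarith
    · exact h
  have hd1 : (1 : ℝ) ≤ d := by exact_mod_cast hd
  have hσ2 : 0 < 2 * η / βv := by positivity
  rw [gaussMeasure_eq_map_stdGaussian _ hσ2, Measure.map_apply (by fun_prop)
    (Metric.isClosed_closedBall.measurableSet.inter Metric.isClosed_closedBall.measurableSet)]
  set σ := Real.sqrt (2 * η / βv) with hσ
  have hσ0 : 0 < σ := Real.sqrt_pos.mpr hσ2
  set D := L * R + G
  have hsmall' : r ^ 2 / R + η * D ≤ 1 / 40 * σ := by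
    have h1 : Real.sqrt (βv / (2 * η)) = σ⁻¹ := by rw [hσ, ← Real.sqrt_inv, inv_div]
    rw [h1, inv_mul_le_iff₀ hσ0] at hsmall
    linarith
  set s := Real.sqrt (5 * d) with hs
  have hs2 : s ^ 2 = 5 * d := Real.sq_sqrt (by positivity)
  have hs0 : 0 ≤ s := Real.sqrt_nonneg _
  have hrs : r = s * σ := by
    rw [hr, hs, hσ, ← Real.sqrt_mul (by positivity)]
    congr 1; ring
  have hs_two : 2 ≤ s := by nlinarith
  obtain ⟨e, he, heu⟩ : ∃ e : EuclideanSpace ℝ (Fin d), ‖e‖ = 1 ∧ (R / 2 ≤ ‖u‖ → u = ‖u‖ • e) := by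
    by_cases hu0 : u = 0
    · refine ⟨EuclideanSpace.single ⟨0, hd⟩ 1, by simp, fun _ => by simp [hu0]⟩
    · have : ‖u‖ ≠ 0 := norm_ne_zero_iff.mpr hu0
      exact ⟨‖u‖⁻¹ • u, by rw [norm_smul]; simp [this], fun _ => by rw [smul_inv_smul₀ this]⟩
  set ρ := s - 1 / 40 with hρ
  have hρ0 : 0 < ρ := by rw [hρ]; linarith
  have hprob := stdGaussian_real_norm_le_inter_inner_le he hρ0 (δ := 1 / 40) (by norm_num)
  have htail : 3 * (d : ℝ) ^ 2 / ρ ^ 4 ≤ 0.15 := by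
    rw [div_le_iff₀ (by positivity)]
    have h1 : 4.5 * d ≤ ρ ^ 2 := by rw [hρ]; nlinarith
    have h2 : (4.5 * (d : ℝ)) ^ 2 ≤ (ρ ^ 2) ^ 2 := by gcongr
    nlinarith
  have hcap : ENNReal.ofReal 0.4 ≤ ProbabilityTheory.stdGaussian (EuclideanSpace ℝ (Fin d))
      {z | ‖z‖ ≤ ρ ∧ inner ℝ e z ≤ -(1 / 40)} := by
    rw [← ofReal_measureReal]
    apply ENNReal.ofReal_le_ofReal
    linarith
  refine hcap.trans (measure_mono ?_)
  rintro z ⟨hz1, hz2⟩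
  have hpt : σ • z + (u - η • g) = u + (σ • z - η • g) := by abel
  simp only [Set.mem_preimage, hpt, Set.mem_inter_iff, mem_closedBall_iff_norm, sub_zero,
    add_sub_cancel_left]
  exact norm_add_sub_le_of_inner_le hR hη hσ0 hs_two hrs hsmall' hu hg heu hz1 hz2
end

section
/- Let f be continuously differentiable, (m,b)-dissipative, and L-smooth with m ≤ L, let x* be a global minimizer of f, and let π be the probability measure on ℝ^d with density proportional to e^{−βf(x)}. Then for every ζ ∈ (0,1), the closed ball Ω = B(0, R̄(ζ)) satisfies π(Ω) ≥ 1 − ζ. -/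
open MeasureTheory
open scoped InnerProductSpace

/-- The radius `R̄(z)` from the paper. -/
noncomputable def Rbar (m b βv L : ℝ) (d : ℕ) (z : ℝ) : ℝ :=
  Real.sqrt (max (625 * d * Real.log (4 / z) / (m * βv))
    (max ((4 * d * Real.log (4 * L / m) + 4 * βv * b) / (m * βv))
      ((4 * d + 8 * Real.sqrt (d * Real.log (1 / z)) + 8 * Real.log (1 / z)) / (m * βv))))

/-- Radial growth of a dissipative function between `x / 2` and `x`. -/
theorem growth_of_dissipative {E : Type*} [NormedAddCommGroup E] [InnerProductSpace ℝ E]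
    [CompleteSpace E] {f : E → ℝ} {m b : ℝ} (hf : Differentiable ℝ f)
    (hdiss : ∀ x, m * ‖x‖ ^ 2 - b ≤ ⟪gradient f x, x⟫_ℝ) (x : E) :
    f ((2 : ℝ)⁻¹ • x) + 3 / 8 * m * ‖x‖ ^ 2 - b * Real.log 2 ≤ f x := by
  set h : ℝ → ℝ := fun t => f (t • x) - m / 2 * ‖x‖ ^ 2 * t ^ 2 + b * Real.log t with hh
  have hderiv : ∀ t : ℝ, 0 < t → HasDerivAt h
      (⟪gradient f (t • x), x⟫_ℝ - m / 2 * ‖x‖ ^ 2 * (2 * t) + b * t⁻¹) t := by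
    intro t ht
    have hfx : HasDerivAt (fun s : ℝ => f (s • x)) ⟪gradient f (t • x), x⟫_ℝ t := by
      have hray : HasDerivAt (fun s : ℝ => s • x) x t := by
        simpa using (hasDerivAt_id t).smul_const x
      have hgrad := (hf (t • x)).hasGradientAt.hasFDerivAt
      simpa [Function.comp_def] using hgrad.comp_hasDerivAt t hray
    have hsq : HasDerivAt (fun s : ℝ => s ^ 2) (2 * t) t := by
      simpa using hasDerivAt_pow 2 t
    exact (hfx.sub (hsq.const_mul _)).add ((Real.hasDerivAt_log ht.ne').const_mul b)
  have hmono : MonotoneOn h (Set.Icc 2⁻¹ 1) := by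
    have hpos : ∀ t ∈ Set.Icc (2⁻¹ : ℝ) 1, 0 < t := fun t ht =>
      lt_of_lt_of_le (by norm_num) ht.1
    refine monotoneOn_of_deriv_nonneg (convex_Icc _ _)
      (fun t ht => (hderiv t (hpos t ht)).continuousAt.continuousWithinAt)
      (fun t ht => (hderiv t (hpos t (interior_subset ht))).differentiableAt.differentiableWithinAt)
      fun t ht => ?_
    have ht0 := hpos t (interior_subset ht)
    rw [(hderiv t ht0).deriv]
    have hd := hdiss (t • x)
    rw [norm_smul, Real.norm_of_nonneg ht0.le, real_inner_smul_right] at hd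
    have heq : ⟪gradient f (t • x), x⟫_ℝ - m / 2 * ‖x‖ ^ 2 * (2 * t) + b * t⁻¹
        = t⁻¹ * (t * ⟪gradient f (t • x), x⟫_ℝ - m * (t * ‖x‖) ^ 2 + b) := by
      field_simp
    rw [heq]
    exact mul_nonneg (inv_nonneg.2 ht0.le) (by linarith)
  have hle := hmono (Set.left_mem_Icc.2 (by norm_num)) (Set.right_mem_Icc.2 (by norm_num))
    (by norm_num : (2⁻¹ : ℝ) ≤ 1)
  simp only [hh, one_smul, Real.log_inv, Real.log_one] at hle
  linarith

theorem integrable_exp_neg_mul_norm_sq {V : Type*} [NormedAddCommGroup V]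
    [InnerProductSpace ℝ V] [FiniteDimensional ℝ V] [MeasurableSpace V] [BorelSpace V]
    {c : ℝ} (hc : 0 < c) : Integrable (fun v : V => Real.exp (-c * ‖v‖ ^ 2)) := by
  have h := (GaussianFourier.integrable_cexp_neg_mul_sq_norm_add (V := V) (b := (c : ℂ))
    (by simpa using hc) 0 0).norm
  refine h.congr (Filter.Eventually.of_forall fun v => ?_)
  simp [Complex.norm_exp, ← Complex.ofReal_pow]

/-- The Gibbs weight of a dissipative function that is bounded below is integrable. -/
theorem integrable_exp_neg_of_dissipative {V : Type*} [NormedAddCommGroup V]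
    [InnerProductSpace ℝ V] [FiniteDimensional ℝ V] [MeasurableSpace V] [BorelSpace V]
    {f : V → ℝ} {m b βv a : ℝ} (hm : 0 < m) (hβ : 0 < βv) (hf : Differentiable ℝ f)
    (hdiss : ∀ x, m * ‖x‖ ^ 2 - b ≤ ⟪gradient f x, x⟫_ℝ) (ha : ∀ x, a ≤ f x) :
    Integrable (fun x => Real.exp (-βv * f x)) := by
  refine ((integrable_exp_neg_mul_norm_sq (V := V) (c := βv * (3 / 8 * m))
    (by positivity)).const_mul (Real.exp (-βv * (a - b * Real.log 2)))).mono'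
    (by have := hf.continuous; fun_prop) (Filter.Eventually.of_forall fun x => ?_)
  rw [Real.norm_of_nonneg (Real.exp_pos _).le, ← Real.exp_add, Real.exp_le_exp]
  have hg := growth_of_dissipative hf hdiss x
  have := mul_le_mul_of_nonneg_left
    (show a - b * Real.log 2 + 3 / 8 * m * ‖x‖ ^ 2 ≤ f x by linarith [ha ((2 : ℝ)⁻¹ • x)]) hβ.le
  linarith

theorem le_of_Rbar_lt {m b βv L z r : ℝ} {d : ℕ} (hm : 0 < m) (hb : 0 ≤ b) (hβ : 0 < βv)
    (hmL : m ≤ L) (hz : z ∈ Set.Ioo (0 : ℝ) 1) (hr : Rbar m b βv L d z < r) :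
    (d + βv * b) * Real.log 2 - Real.log z ≤ βv * (3 / 8 * m * r ^ 2) := by
  have hsq := Real.lt_sq_of_sqrt_lt hr
  have hmβ : 0 < m * βv := mul_pos hm hβ
  have hB := ((le_max_left _ _).trans (le_max_right _ _)).trans_lt hsq
  have hC := ((le_max_right _ _).trans (le_max_right _ _)).trans_lt hsq
  rw [div_lt_iff₀ hmβ] at hB hC
  have hlogL : 0 ≤ Real.log (4 * L / m) :=
    Real.log_nonneg (by rw [le_div_iff₀ hm]; linarith)
  have hd : (0 : ℝ) ≤ d := d.cast_nonneg
  have hdL : 0 ≤ d * Real.log (4 * L / m) := mul_nonneg hd hlogL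
  have hsqrt := Real.sqrt_nonneg (d * Real.log (1 / z))
  have hlogz := Real.log_neg hz.1 hz.2
  rw [one_div, Real.log_inv] at hC hsqrt
  have hlog2 : (d + βv * b) * Real.log 2 ≤ (d + βv * b) * (3 / 4) :=
    mul_le_mul_of_nonneg_left (by linarith [Real.log_two_lt_d9]) (by positivity)
  linarith


theorem statement4 {d : ℕ} (f : EuclideanSpace ℝ (Fin d) → ℝ) (m b L βv : ℝ)
    (hm : 0 < m) (hb : 0 ≤ b) (hβ : 0 < βv) (hmL : m ≤ L) (hf : ContDiff ℝ 1 f)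
    (hdiss : ∀ x : EuclideanSpace ℝ (Fin d), m * ‖x‖ ^ 2 - b ≤ ⟪gradient f x, x⟫_ℝ)
    (hsmooth : ∀ x y : EuclideanSpace ℝ (Fin d),
      ‖gradient f x - gradient f y‖ ≤ L * ‖x - y‖)
    (xstar : EuclideanSpace ℝ (Fin d)) (hmin : ∀ y, f xstar ≤ f y)
    (π : Measure (EuclideanSpace ℝ (Fin d)))
    (hπ : π = volume.withDensity fun x =>
      ENNReal.ofReal (Real.exp (-βv * f x) / ∫ y, Real.exp (-βv * f y)))
    (ζ : ℝ) (hζ : ζ ∈ Set.Ioo (0 : ℝ) 1) :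
    ENNReal.ofReal (1 - ζ) ≤ π (Metric.closedBall (0 : EuclideanSpace ℝ (Fin d)) (Rbar m b βv L d ζ)) := by
  have hdf : Differentiable ℝ f := hf.differentiable one_ne_zero
  have hint := integrable_exp_neg_of_dissipative hm hβ hdf hdiss hmin
  set Z := ∫ y, Real.exp (-βv * f y) with hZ
  have hZpos : 0 < Z := integral_exp_pos hint
  set p : EuclideanSpace ℝ (Fin d) → ℝ := fun x => Real.exp (-βv * f x) / Z with hp
  have hpint : Integrable p := hint.div_const Z
  have hpnn : ∀ x, 0 ≤ p x := fun x => by positivity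
  have hpone : ∫ x, p x = 1 := by rw [hp, integral_div, ← hZ, div_self hZpos.ne']
  have hπapply : ∀ s, MeasurableSet s → π s = ENNReal.ofReal (∫ x in s, p x) := fun s hs => by
    rw [hπ, withDensity_apply _ hs, ofReal_integral_eq_lintegral_ofReal hpint.integrableOn
      (Filter.Eventually.of_forall hpnn)]
  set B := Metric.closedBall (0 : EuclideanSpace ℝ (Fin d)) (Rbar m b βv L d ζ)
  have hBm : MeasurableSet B := measurableSet_closedBall
  rw [hπapply B hBm]
  apply ENNReal.ofReal_le_ofReal
  have hcint : Integrable (fun x => ζ / 2 ^ d * p ((2 : ℝ)⁻¹ • x)) :=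
    (hpint.comp_smul (by norm_num)).const_mul _
  have htail : ∫ x in Bᶜ, p x ≤ ζ := by
    calc ∫ x in Bᶜ, p x ≤ ∫ x in Bᶜ, ζ / 2 ^ d * p ((2 : ℝ)⁻¹ • x) := by
          refine setIntegral_mono_on hpint.integrableOn hcint.integrableOn hBm.compl fun x hx => ?_
          have hr : Rbar m b βv L d ζ < ‖x‖ := by simpa [B] using hx
          have hrad := le_of_Rbar_lt hm hb hβ hmL hζ hr
          have hg := mul_le_mul_of_nonneg_left (growth_of_dissipative hdf hdiss x) hβ.le
          have hconst : ζ / 2 ^ d = Real.exp (Real.log ζ - d * Real.log 2) := by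
            rw [Real.exp_sub, Real.exp_log hζ.1, Real.exp_nat_mul, Real.exp_log two_pos]
          simp only [hp]
          rw [← mul_div_assoc, hconst, ← Real.exp_add]
          gcongr
          linarith
      _ ≤ ∫ x, ζ / 2 ^ d * p ((2 : ℝ)⁻¹ • x) :=
          setIntegral_le_integral hcint (Filter.Eventually.of_forall fun x =>
            mul_nonneg (div_nonneg hζ.1.le (by positivity)) (hpnn _))
      _ = ζ := by
          rw [integral_const_mul, Measure.integral_comp_inv_smul, hpone, finrank_euclideanSpace_fin,
            abs_of_pos (by positivity), smul_eq_mul, mul_one, div_mul_cancel₀ _ (by positivity)]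
  have hsum := integral_add_compl hBm hpint
  linarith
end

section
/- Let T* be a 1/2-lazy, time-reversible Markov kernel on a measurable set Ω ⊆ ℝ^d with stationary probability distribution π*, where π* is atom-free, and let φ denote the conductance of T*. Let T be a 1/2-lazy Markov kernel on Ω that is δ-close to T* with δ ≤ min{1 − √2/2, φ/16}. Let μ₀ be a λ-warm start with respect to π* and let μ_K be the distribution after K steps of the chain with kernel T started from μ₀. Then ‖μ_K − π*‖_TV ≤ λ(1 − φ²/8)^K + 16δ/φ. -/
open MeasureTheory ProbabilityTheory
open scoped ENNReal

/-- The distribution of the Markov chain with transition kernel `T` started from `μ0`,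
after `k` steps. -/
noncomputable def chainDist {d : ℕ}
    (T : Kernel (EuclideanSpace ℝ (Fin d)) (EuclideanSpace ℝ (Fin d)))
    (μ0 : Measure (EuclideanSpace ℝ (Fin d))) : ℕ → Measure (EuclideanSpace ℝ (Fin d))
  | 0 => μ0
  | k + 1 => (chainDist T μ0 k).bind fun u => T u

/-- The conductance of a Markov kernel `T` on `Ω` with stationary distribution `π`. -/
noncomputable def conductance {d : ℕ}
    (T : Kernel (EuclideanSpace ℝ (Fin d)) (EuclideanSpace ℝ (Fin d)))
    (Ω : Set (EuclideanSpace ℝ (Fin d))) (π : Measure (EuclideanSpace ℝ (Fin d))) : ℝ :=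
  sInf { r : ℝ | ∃ A : Set (EuclideanSpace ℝ (Fin d)), MeasurableSet A ∧ A ⊆ Ω ∧
    0 < π A ∧ π A < 1 ∧
    r = (∫ u in A, (T u (Ω \ A)).toReal ∂π) / min (π A).toReal (π (Ω \ A)).toReal }

/-- The concave profile `x ↦ min (√x) (√(1 - x))` controlling the discrepancy of two measures. -/
noncomputable def sqrtProfile (x : ℝ) : ℝ := min (Real.sqrt x) (Real.sqrt (1 - x))

lemma sqrtProfile_nonneg (x : ℝ) : 0 ≤ sqrtProfile x :=
  le_min (Real.sqrt_nonneg _) (Real.sqrt_nonneg _)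

lemma sqrtProfile_zero : sqrtProfile 0 = 0 := by simp [sqrtProfile]

lemma sqrtProfile_le_one {x : ℝ} (hx : x ≤ 1) : sqrtProfile x ≤ 1 :=
  (min_le_left _ _).trans (Real.sqrt_le_one.mpr hx)

lemma continuous_sqrtProfile : Continuous sqrtProfile := by
  unfold sqrtProfile; fun_prop

lemma concaveOn_sqrtProfile : ConcaveOn ℝ (Set.Icc 0 1) sqrtProfile := by
  have h1 : ConcaveOn ℝ (Set.Icc (0 : ℝ) 1) Real.sqrt :=
    Real.strictConcaveOn_sqrt.concaveOn.subset (fun x hx => hx.1) (convex_Icc 0 1)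
  have h2 : ConcaveOn ℝ (Set.Icc (0 : ℝ) 1) (fun x => Real.sqrt (1 - x)) := by
    refine ⟨convex_Icc 0 1, fun x hx y hy a b ha hb hab => ?_⟩
    have h := h1.2 (x := 1 - x) (y := 1 - y) ⟨by linarith [hx.2], by linarith [hx.1]⟩
      ⟨by linarith [hy.2], by linarith [hy.1]⟩ ha hb hab
    convert h using 2
    simp only [smul_eq_mul]
    linear_combination -hab
  exact h1.inf h2

lemma sqrt_add_sqrt_le {y b : ℝ} (hy0 : 0 ≤ y) (hy1 : y ≤ 1) (hb0 : 0 ≤ b) (hb1 : b ≤ 1) :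
    Real.sqrt (1 - y + b) + Real.sqrt (1 + y + b) ≤ 2 + b - y ^ 2 / 8 := by
  have hP := Real.sq_sqrt (show 0 ≤ 1 - y + b by linarith)
  have hR := Real.sq_sqrt (show 0 ≤ 1 + y + b by linarith)
  have hP0 := Real.sqrt_nonneg (1 - y + b)
  have hR0 := Real.sqrt_nonneg (1 + y + b)
  set P := Real.sqrt (1 - y + b)
  set R := Real.sqrt (1 + y + b)
  have hyy : y ^ 2 ≤ 1 := pow_le_one₀ hy0 hy1
  have hPR : P * R ≤ 1 + b - y ^ 2 / 4 := by
    refine abs_le_of_sq_le_sq' ?_ (by linarith) |>.2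
    rw [mul_pow, hP, hR]
    nlinarith [sq_nonneg (y ^ 2), mul_nonneg (sq_nonneg y) (sub_nonneg.2 hb1)]
  refine abs_le_of_sq_le_sq' ?_ (by linarith) |>.2
  nlinarith [sq_nonneg (b - y ^ 2 / 8)]

lemma contraction_of_flow {X Q δ φ p q : ℝ} (hX0 : 0 ≤ X) (hX1 : X ≤ 1)
    (hQφ : φ * X ≤ Q) (hQ : 2 * Q ≤ X) (hφ : 0 ≤ φ) (hδ0 : 0 ≤ δ) (hδφ : δ ≤ φ / 16)
    (hp : 0 ≤ p) (hq : 0 ≤ q) (hqφ : q * φ = 16 * δ) :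
    2 * δ * Q + (p + q) / 2 *
        (Real.sqrt (X - 2 * (1 - δ) * Q) + Real.sqrt (X + 2 * (1 + δ) * Q)) ≤
      (p * (1 - φ ^ 2 / 8) + q) * Real.sqrt X := by
  rcases hX0.eq_or_lt with rfl | hX
  · have : Q = 0 := by linarith
    simp [this]
  obtain ⟨y, rfl⟩ : ∃ y, Q = y * X / 2 := ⟨2 * Q / X, by field_simp⟩
  have hy1 : y ≤ 1 := by
    by_contra! h
    nlinarith
  have hyφ : 2 * φ ≤ y := by
    by_contra! h
    nlinarith
  have hy0 : 0 ≤ y := by linarith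
  have hS := Real.sq_sqrt hX0
  have hS0 := Real.sqrt_nonneg X
  have hS1 : Real.sqrt X ≤ 1 := Real.sqrt_le_one.mpr hX1
  have e1 : Real.sqrt (X - 2 * (1 - δ) * (y * X / 2)) =
      Real.sqrt X * Real.sqrt (1 - y + δ * y) := by
    rw [← Real.sqrt_mul hX0]; congr 1; ring
  have e2 : Real.sqrt (X + 2 * (1 + δ) * (y * X / 2)) =
      Real.sqrt X * Real.sqrt (1 + y + δ * y) := by
    rw [← Real.sqrt_mul hX0]; congr 1; ring
  have key := sqrt_add_sqrt_le hy0 hy1 (mul_nonneg hδ0 hy0) (b := δ * y) (by nlinarith)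
  rw [e1, e2, ← mul_add]
  set S := Real.sqrt X
  have hXS : X ≤ S := by nlinarith
  have h1 : (p + q) / 2 * (S * (Real.sqrt (1 - y + δ * y) + Real.sqrt (1 + y + δ * y))) ≤
      (p + q) / 2 * (S * (2 + δ * y - y ^ 2 / 8)) := by gcongr
  have h2 : 2 * δ * (y * X / 2) ≤ δ * y * S := by
    have := mul_le_mul_of_nonneg_left hXS (mul_nonneg hδ0 hy0)
    linarith
  have hgap : 3 * φ / 32 ≤ y / 16 - δ / 2 := by linarith
  have h3 : δ * y ≤ q * (y * (y / 16 - δ / 2)) := by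
    have := mul_le_mul_of_nonneg_left hgap (mul_nonneg hq hy0)
    nlinarith [mul_nonneg hδ0 hy0]
  have h4 : φ ^ 2 / 8 ≤ y * (y / 16 - δ / 2) := by
    have := mul_le_mul hyφ hgap (by positivity) hy0
    nlinarith [sq_nonneg φ]
  have h5 := mul_le_mul_of_nonneg_left h4 hp
  have h6 : δ * y + (p + q) * (1 - y * (y / 16 - δ / 2)) ≤ p * (1 - φ ^ 2 / 8) + q := by
    linarith
  have h7 := mul_le_mul_of_nonneg_right h6 hS0
  linarith

lemma sqrtProfile_contraction {x Q a b δ φ p q : ℝ} (hx0 : 0 ≤ x) (hx1 : x ≤ 1)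
    (hQφ : φ * min x (1 - x) ≤ Q) (hQx : 2 * Q ≤ x) (hQx' : 2 * Q ≤ 1 - x)
    (ha : (1 - δ) * Q ≤ a) (ha' : a ≤ (1 + δ) * Q)
    (hb : (1 - δ) * Q ≤ b) (hb' : b ≤ (1 + δ) * Q)
    (hφ : 0 ≤ φ) (hδ0 : 0 ≤ δ) (hδφ : δ ≤ φ / 16)
    (hp : 0 ≤ p) (hq : 0 ≤ q) (hqφ : q * φ = 16 * δ) :
    x + (b - a) + (p + q) / 2 * (sqrtProfile (x - 2 * a) + sqrtProfile (x + 2 * b)) ≤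
      x + (p * (1 - φ ^ 2 / 8) + q) * sqrtProfile x := by
  have hc : 0 ≤ (p + q) / 2 := by positivity
  have hba : b - a ≤ 2 * δ * Q := by linarith
  rcases le_total x (1 - x) with h | h
  · have hs : sqrtProfile x = Real.sqrt x := min_eq_left (Real.sqrt_le_sqrt h)
    rw [min_eq_left h] at hQφ
    have key := contraction_of_flow hx0 hx1 hQφ hQx hφ hδ0 hδφ hp hq hqφ
    have h1 : sqrtProfile (x - 2 * a) ≤ Real.sqrt (x - 2 * (1 - δ) * Q) :=
      (min_le_left _ _).trans (Real.sqrt_le_sqrt (by linarith))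
    have h2 : sqrtProfile (x + 2 * b) ≤ Real.sqrt (x + 2 * (1 + δ) * Q) :=
      (min_le_left _ _).trans (Real.sqrt_le_sqrt (by linarith))
    have h3 := mul_le_mul_of_nonneg_left (add_le_add h1 h2) hc
    rw [hs]; linarith
  · have hs : sqrtProfile x = Real.sqrt (1 - x) := min_eq_right (Real.sqrt_le_sqrt h)
    rw [min_eq_right h] at hQφ
    have key := contraction_of_flow (by linarith) (by linarith) hQφ hQx' hφ hδ0 hδφ hp hq hqφ
    have h1 : sqrtProfile (x + 2 * b) ≤ Real.sqrt (1 - x - 2 * (1 - δ) * Q) :=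
      (min_le_right _ _).trans (Real.sqrt_le_sqrt (by linarith))
    have h2 : sqrtProfile (x - 2 * a) ≤ Real.sqrt (1 - x + 2 * (1 + δ) * Q) :=
      (min_le_right _ _).trans (Real.sqrt_le_sqrt (by linarith))
    have h3 := mul_le_mul_of_nonneg_left (add_le_add h1 h2) hc
    rw [hs]; linarith

section

variable {α : Type*} [MeasurableSpace α]

lemma absolutelyContinuous_of_le_sqrtProfile {μ π : Measure α} [IsProbabilityMeasure μ]
    [IsProbabilityMeasure π] {c : ℝ}
    (h : ∀ B, MeasurableSet B → μ.real B ≤ π.real B + c * sqrtProfile (π.real B)) : μ ≪ π := by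
  refine Measure.AbsolutelyContinuous.mk fun B hB h0 => ?_
  have := h B hB
  rw [measureReal_def, measureReal_def, h0] at this
  simp only [ENNReal.toReal_zero, sqrtProfile_zero, mul_zero, add_zero] at this
  exact (measureReal_eq_zero_iff (μ := μ)).1 (le_antisymm this measureReal_nonneg)

lemma integral_le_of_le_sqrtProfile {μ π : Measure α} [IsProbabilityMeasure μ]
    [IsProbabilityMeasure π] {c : ℝ} (hc : 0 ≤ c)
    (h : ∀ B, MeasurableSet B → μ.real B ≤ π.real B + c * sqrtProfile (π.real B))
    {g : α → ℝ} (hg : Measurable g) (hg0 : ∀ᵐ u ∂π, 0 ≤ g u) (hg1 : ∀ᵐ u ∂π, g u ≤ 1) :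
    ∫ u, g u ∂μ ≤ ∫ u, g u ∂π + c * sqrtProfile (∫ u, g u ∂π) := by
  have hac := absolutelyContinuous_of_le_sqrtProfile h
  have hintg : ∀ ν : Measure α, [IsProbabilityMeasure ν] → ν ≪ π → Integrable g ν := by
    intro ν _ hν
    refine Integrable.of_bound hg.aestronglyMeasurable 1 ?_
    filter_upwards [hν.ae_le hg0, hν.ae_le hg1] with u h0 h1
    rw [Real.norm_eq_abs, abs_of_nonneg h0]; exact h1
  have hmeas : ∀ ν : Measure α, [IsProbabilityMeasure ν] →
      Measurable fun t : ℝ => ν.real {a | t ≤ g a} := by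
    intro ν _
    refine Antitone.measurable fun s t hst => ?_
    exact measureReal_mono fun a (ha : t ≤ g a) => hst.trans ha
  have hlayer : ∀ ν : Measure α, [IsProbabilityMeasure ν] → ν ≪ π →
      ∫ u, g u ∂ν = ∫ t in Set.Ioc (0 : ℝ) 1, ν.real {a | t ≤ g a} := fun ν _ hν =>
    (hintg ν hν).integral_eq_integral_Ioc_meas_le (hν.ae_le hg0) (hν.ae_le hg1)
  have : IsProbabilityMeasure (volume.restrict (Set.Ioc (0 : ℝ) 1)) := ⟨by simp⟩
  have hI : ∀ ν : Measure α, [IsProbabilityMeasure ν] →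
      Integrable (fun t : ℝ => ν.real {a | t ≤ g a}) (volume.restrict (Set.Ioc (0 : ℝ) 1)) := by
    intro ν _
    refine Integrable.of_bound (hmeas ν).aestronglyMeasurable 1 (ae_of_all _ fun t => ?_)
    rw [Real.norm_eq_abs, abs_of_nonneg measureReal_nonneg]
    exact measureReal_le_one
  have hIs : Integrable (fun t : ℝ => sqrtProfile (π.real {a | t ≤ g a}))
      (volume.restrict (Set.Ioc (0 : ℝ) 1)) := by
    refine Integrable.of_bound
      (continuous_sqrtProfile.measurable.comp (hmeas π)).aestronglyMeasurable 1
      (ae_of_all _ fun t => ?_)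
    rw [Real.norm_eq_abs, abs_of_nonneg (sqrtProfile_nonneg _)]
    exact sqrtProfile_le_one measureReal_le_one
  have hJ := concaveOn_sqrtProfile.le_map_integral continuous_sqrtProfile.continuousOn
    isClosed_Icc (ae_of_all _ fun t => ⟨measureReal_nonneg, measureReal_le_one⟩) (hI π) hIs
  rw [hlayer μ hac, hlayer π .rfl]
  calc ∫ t in Set.Ioc (0 : ℝ) 1, μ.real {a | t ≤ g a}
      ≤ ∫ t in Set.Ioc (0 : ℝ) 1,
          (π.real {a | t ≤ g a} + c * sqrtProfile (π.real {a | t ≤ g a})) :=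
        integral_mono (hI μ) ((hI π).add (hIs.const_mul c))
          fun t => h _ (measurableSet_le measurable_const hg)
    _ = (∫ t in Set.Ioc (0 : ℝ) 1, π.real {a | t ≤ g a}) +
          c * ∫ t in Set.Ioc (0 : ℝ) 1, sqrtProfile (π.real {a | t ≤ g a}) := by
        rw [integral_add (hI π) (hIs.const_mul c), integral_const_mul]
    _ ≤ _ := by gcongr

lemma measurable_kernel_real (T : Kernel α α) {A : Set α} (hA : MeasurableSet A) :
    Measurable fun u => (T u).real A :=
  (T.measurable_coe hA).ennreal_toReal

lemma integrable_kernel_real (T : Kernel α α) [IsMarkovKernel T] {A : Set α}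
    (hA : MeasurableSet A) (μ : Measure α) [IsFiniteMeasure μ] :
    Integrable (fun u => (T u).real A) μ := by
  refine Integrable.of_bound (measurable_kernel_real T hA).aestronglyMeasurable 1
    (ae_of_all _ fun t => ?_)
  rw [Real.norm_eq_abs, abs_of_nonneg measureReal_nonneg]
  exact measureReal_le_one

lemma setIntegral_kernel_real (T : Kernel α α) [IsMarkovKernel T] {A : Set α}
    (hA : MeasurableSet A) (μ : Measure α) [IsFiniteMeasure μ] (B : Set α) :
    ∫ u in B, (T u).real A ∂μ = (∫⁻ u in B, T u A ∂μ).toReal :=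
  integral_toReal (T.measurable_coe hA).aemeasurable
    (ae_of_all _ fun _ => measure_lt_top _ _)

lemma bind_real_eq_integral (T : Kernel α α) [IsMarkovKernel T] {A : Set α}
    (hA : MeasurableSet A) (μ : Measure α) [IsFiniteMeasure μ] :
    (μ.bind fun u => T u).real A = ∫ u, (T u).real A ∂μ := by
  rw [measureReal_def, Measure.bind_apply hA T.measurable.aemeasurable]
  exact (integral_toReal (T.measurable_coe hA).aemeasurable
    (ae_of_all _ fun _ => measure_lt_top _ _)).symm

lemma bind_real_le_of_lazy (T : Kernel α α) [IsMarkovKernel T] {μ π : Measure α}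
    [IsProbabilityMeasure μ] [IsProbabilityMeasure π] {c : ℝ} (hc : 0 ≤ c)
    (h : ∀ B, MeasurableSet B → μ.real B ≤ π.real B + c * sqrtProfile (π.real B))
    {A : Set α} (hA : MeasurableSet A)
    (hlazy : ∀ᵐ u ∂π, u ∈ A → 1 / 2 ≤ (T u).real A)
    (hlazy' : ∀ᵐ u ∂π, u ∈ Aᶜ → (T u).real A ≤ 1 / 2) :
    (μ.bind fun u => T u).real A ≤
      π.real A + ((∫ u in Aᶜ, (T u).real A ∂π) - ∫ u in A, (T u).real Aᶜ ∂π) +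
        c / 2 * (sqrtProfile (π.real A - 2 * ∫ u in A, (T u).real Aᶜ ∂π) +
          sqrtProfile (π.real A + 2 * ∫ u in Aᶜ, (T u).real A ∂π)) := by
  have hmA := measurable_kernel_real T hA
  have hmA' := measurable_kernel_real T hA.compl
  set g₁ : α → ℝ := A.indicator fun u => 1 - 2 * (T u).real Aᶜ
  set g₂ : α → ℝ := fun u => A.indicator (fun _ => 1) u + 2 * Aᶜ.indicator (fun u => (T u).real A) u
  have hT : ∀ u, (T u).real Aᶜ = 1 - (T u).real A := fun u => probReal_compl_eq_one_sub hA
  have hg₁ : Measurable g₁ := (measurable_const.sub (hmA'.const_mul 2)).indicator hA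
  have hg₂ : Measurable g₂ :=
    (measurable_const.indicator hA).add ((hmA.indicator hA.compl).const_mul 2)
  have hsum : ∀ u, (T u).real A = (g₁ u + g₂ u) / 2 := by
    intro u
    by_cases hu : u ∈ A <;> simp [g₁, g₂, hu, hT]
    ring
  have b₁ : ∀ᵐ u ∂π, 0 ≤ g₁ u ∧ g₁ u ≤ 1 := by
    filter_upwards [hlazy] with u hl
    by_cases hu : u ∈ A
    · simp only [g₁, Set.indicator_of_mem hu, hT]
      have := hl hu
      have : (T u).real A ≤ 1 := measureReal_le_one
      constructor <;> linarith
    · simp [g₁, hu]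
  have b₂ : ∀ᵐ u ∂π, 0 ≤ g₂ u ∧ g₂ u ≤ 1 := by
    filter_upwards [hlazy'] with u hl
    by_cases hu : u ∈ A
    · simp [g₂, hu]
    · simp only [g₂, Set.indicator_of_notMem hu, Set.indicator_of_mem (Set.mem_compl hu)]
      have := hl hu
      have : 0 ≤ (T u).real A := measureReal_nonneg
      constructor <;> linarith
  have i₁ : ∀ ν : Measure α, [IsProbabilityMeasure ν] → Integrable g₁ ν := fun ν _ =>
    ((integrable_const 1).sub ((integrable_kernel_real T hA.compl ν).const_mul 2)).indicator hA
  have i₂ : ∀ ν : Measure α, [IsProbabilityMeasure ν] → Integrable g₂ ν := fun ν _ =>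
    ((integrable_const 1).indicator hA).add
      (((integrable_kernel_real T hA ν).indicator hA.compl).const_mul 2)
  have e₁ : ∫ u, g₁ u ∂π = π.real A - 2 * ∫ u in A, (T u).real Aᶜ ∂π := by
    rw [integral_indicator hA, integral_sub (integrable_const 1)
      ((integrable_kernel_real T hA.compl _).const_mul 2), integral_const_mul]
    simp
  have e₂ : ∫ u, g₂ u ∂π = π.real A + 2 * ∫ u in Aᶜ, (T u).real A ∂π := by
    rw [integral_add ((integrable_const 1).indicator hA)
      (((integrable_kernel_real T hA π).indicator hA.compl).const_mul 2), integral_const_mul,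
      integral_indicator hA, integral_indicator hA.compl]
    simp
  have k₁ := integral_le_of_le_sqrtProfile hc h hg₁ (b₁.mono fun _ h => h.1) (b₁.mono fun _ h => h.2)
  have k₂ := integral_le_of_le_sqrtProfile hc h hg₂ (b₂.mono fun _ h => h.1) (b₂.mono fun _ h => h.2)
  rw [bind_real_eq_integral T hA, integral_congr_ae (ae_of_all _ hsum), integral_div,
    integral_add (i₁ μ) (i₂ μ)]
  rw [e₁] at k₁
  rw [e₂] at k₂
  linarith

lemma two_mul_setIntegral_kernel_compl_le (T : Kernel α α) [IsMarkovKernel T] {π : Measure α}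
    [IsFiniteMeasure π] {A : Set α} (hA : MeasurableSet A)
    (hlazy : ∀ᵐ u ∂π, u ∈ A → 1 / 2 ≤ (T u).real A) :
    2 * ∫ u in A, (T u).real Aᶜ ∂π ≤ π.real A := by
  have : ∫ u in A, (T u).real Aᶜ ∂π ≤ ∫ _ in A, (1 / 2 : ℝ) ∂π := by
    refine setIntegral_mono_on_ae (integrable_kernel_real T hA.compl _).integrableOn
      (integrable_const _).integrableOn hA ?_
    filter_upwards [hlazy] with u hu huA
    rw [probReal_compl_eq_one_sub hA]
    linarith [hu huA]
  simp only [integral_const, measureReal_restrict_apply_univ, smul_eq_mul] at this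
  linarith

lemma setIntegral_kernel_close {S T : Kernel α α} [IsMarkovKernel S] [IsMarkovKernel T]
    {π : Measure α} [IsFiniteMeasure π] {δ : ℝ} {B : Set α} (hB : MeasurableSet B)
    (hclose : ∀ᵐ u ∂π, (1 - δ) * (S u).real B ≤ (T u).real B ∧
      (T u).real B ≤ (1 + δ) * (S u).real B) (A : Set α) :
    (1 - δ) * ∫ u in A, (S u).real B ∂π ≤ ∫ u in A, (T u).real B ∂π ∧
      ∫ u in A, (T u).real B ∂π ≤ (1 + δ) * ∫ u in A, (S u).real B ∂π := by
  have hS := integrable_kernel_real S hB (π.restrict A)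
  have hT := integrable_kernel_real T hB (π.restrict A)
  have h := ae_restrict_of_ae (s := A) hclose
  rw [← integral_const_mul, ← integral_const_mul]
  exact ⟨integral_mono_ae (hS.const_mul _) hT (h.mono fun _ h => h.1),
    integral_mono_ae hT (hS.const_mul _) (h.mono fun _ h => h.2)⟩

end

section

variable {d : ℕ} {T : Kernel (EuclideanSpace ℝ (Fin d)) (EuclideanSpace ℝ (Fin d))}
  {Ω : Set (EuclideanSpace ℝ (Fin d))} {π : Measure (EuclideanSpace ℝ (Fin d))}

lemma conductance_nonneg : 0 ≤ conductance T Ω π := by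
  refine Real.sInf_nonneg ?_
  rintro r ⟨A, -, -, -, -, rfl⟩
  exact div_nonneg (integral_nonneg fun _ => ENNReal.toReal_nonneg)
    (le_min ENNReal.toReal_nonneg ENNReal.toReal_nonneg)

lemma conductance_mul_min_le [IsMarkovKernel T] [IsProbabilityMeasure π] (hΩ : MeasurableSet Ω)
    (hT : ∀ u ∈ Ω, T u Ωᶜ = 0) (hπ : π Ωᶜ = 0)
    {A : Set (EuclideanSpace ℝ (Fin d))} (hA : MeasurableSet A) :
    conductance T Ω π * min (π.real A) (1 - π.real A) ≤ ∫ u in A, (T u).real Aᶜ ∂π := by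
  have hQ : 0 ≤ ∫ u in A, (T u).real Aᶜ ∂π := integral_nonneg fun _ => measureReal_nonneg
  have hx0 : 0 ≤ π.real A := measureReal_nonneg
  have hx1 : π.real A ≤ 1 := measureReal_le_one
  rcases hx0.eq_or_lt with h0 | h0
  · simpa [← h0] using hQ
  rcases hx1.eq_or_lt with h1 | h1
  · simpa [h1] using hQ
  have hΩae : ∀ᵐ u ∂π, u ∈ Ω := hπ
  have hAΩ : π (A ∩ Ω) = π A := measure_inter_conull hπ
  have hAΩ' : π (Ω \ (A ∩ Ω)) = π Aᶜ := by
    rw [Set.sdiff_inter_self_eq_sdiff, Set.sdiff_eq, Set.inter_comm]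
    exact measure_inter_conull hπ
  have hintg : ∫ u in A ∩ Ω, (T u (Ω \ (A ∩ Ω))).toReal ∂π = ∫ u in A, (T u).real Aᶜ ∂π := by
    have hset : (A ∩ Ω : Set _) =ᵐ[π] A := by
      filter_upwards [hΩae] with u hu
      exact propext ⟨fun h => h.1, fun h => ⟨h, hu⟩⟩
    rw [setIntegral_congr_set hset]
    refine integral_congr_ae (ae_restrict_of_ae ?_)
    filter_upwards [hΩae] with u hu
    rw [Set.sdiff_inter_self_eq_sdiff, Set.sdiff_eq, Set.inter_comm,
      measure_inter_conull (hT u hu)]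
    rfl
  have hle : conductance T Ω π ≤
      (∫ u in A, (T u).real Aᶜ ∂π) / min (π.real A) (1 - π.real A) := by
    refine csInf_le ⟨0, ?_⟩ ⟨A ∩ Ω, hA.inter hΩ, Set.inter_subset_right, ?_, ?_, ?_⟩
    · rintro r ⟨B, -, -, -, -, rfl⟩
      exact div_nonneg (integral_nonneg fun _ => ENNReal.toReal_nonneg)
        (le_min ENNReal.toReal_nonneg ENNReal.toReal_nonneg)
    · rw [hAΩ]; exact (ENNReal.toReal_pos_iff.1 h0).1
    · rw [hAΩ]
      refine lt_of_le_of_ne prob_le_one fun h => h1.ne ?_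
      simp [measureReal_def, h]
    · rw [hintg, hAΩ, hAΩ', ← probReal_compl_eq_one_sub hA]; rfl
  exact (le_div_iff₀ (lt_min h0 (by linarith))).1 hle

lemma conductance_le_half [IsMarkovKernel T] [IsProbabilityMeasure π] (hΩ : MeasurableSet Ω)
    (hT : ∀ u ∈ Ω, T u Ωᶜ = 0) (hπ : π Ωᶜ = 0)
    (hflow : ∀ A, MeasurableSet A → 2 * ∫ u in A, (T u).real Aᶜ ∂π ≤ π.real A ∧
      2 * ∫ u in A, (T u).real Aᶜ ∂π ≤ 1 - π.real A) :
    conductance T Ω π ≤ 1 / 2 := by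
  by_cases hne : ∃ A, MeasurableSet A ∧ 0 < π A ∧ π A < 1
  · obtain ⟨A, hA, h0, h1⟩ := hne
    have hx0 : 0 < π.real A := ENNReal.toReal_pos h0.ne' (measure_ne_top _ _)
    have hx1 : π.real A < 1 := by
      simpa [measureReal_def] using
        (ENNReal.toReal_lt_toReal (measure_ne_top _ _) ENNReal.one_ne_top).2 h1
    have hm : 0 < min (π.real A) (1 - π.real A) := lt_min hx0 (by linarith)
    have hQ : 2 * ∫ u in A, (T u).real Aᶜ ∂π ≤ min (π.real A) (1 - π.real A) :=
      le_min (hflow A hA).1 (hflow A hA).2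
    have := conductance_mul_min_le hΩ hT hπ hA
    by_contra! hlt
    nlinarith
  · have : conductance T Ω π = 0 := by
      unfold conductance
      convert Real.sInf_empty
      refine Set.eq_empty_of_forall_notMem ?_
      rintro r ⟨A, hA, -, h0, h1, -⟩
      exact hne ⟨A, hA, h0, h1⟩
    rw [this]; norm_num

lemma isProbabilityMeasure_chainDist [IsMarkovKernel T] (μ0 : Measure (EuclideanSpace ℝ (Fin d)))
    [IsProbabilityMeasure μ0] (k : ℕ) : IsProbabilityMeasure (chainDist T μ0 k) := by
  induction k with
  | zero => assumption
  | succ k ih =>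
    exact isProbabilityMeasure_bind T.measurable.aemeasurable
      (ae_of_all _ fun _ => inferInstance)

end

theorem statement7 {d : ℕ}
    (Ω : Set (EuclideanSpace ℝ (Fin d))) (hΩ : MeasurableSet Ω)
    (Tstar T : Kernel (EuclideanSpace ℝ (Fin d)) (EuclideanSpace ℝ (Fin d)))
    [IsMarkovKernel Tstar] [IsMarkovKernel T]
    (hTstarSupp : ∀ u ∈ Ω, Tstar u Ωᶜ = 0)
    (hTSupp : ∀ u ∈ Ω, T u Ωᶜ = 0)
    (hTstarLazy : ∀ u ∈ Ω, (2⁻¹ : ℝ≥0∞) ≤ Tstar u {u})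
    (hTLazy : ∀ u ∈ Ω, (2⁻¹ : ℝ≥0∞) ≤ T u {u})
    (πs : Measure (EuclideanSpace ℝ (Fin d))) [IsProbabilityMeasure πs]
    (hπsSupp : πs Ωᶜ = 0)
    (hrev : ∀ A B : Set (EuclideanSpace ℝ (Fin d)), MeasurableSet A → MeasurableSet B →
      ∫⁻ u in A, Tstar u B ∂πs = ∫⁻ u in B, Tstar u A ∂πs)
    (hstat : ∀ A : Set (EuclideanSpace ℝ (Fin d)), MeasurableSet A →
      ∫⁻ u, Tstar u A ∂πs = πs A)
    (hatomfree : ∀ u, πs {u} = 0)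
    (δ : ℝ) (hδ0 : 0 ≤ δ)
    (hδ : δ ≤ min (1 - Real.sqrt 2 / 2) (conductance Tstar Ω πs / 16))
    (hclose : ∀ u ∈ Ω, ∀ A : Set (EuclideanSpace ℝ (Fin d)), MeasurableSet A → A ⊆ Ω →
      ENNReal.ofReal (1 - δ) * Tstar u A ≤ T u A ∧ T u A ≤ ENNReal.ofReal (1 + δ) * Tstar u A)
    (lam : ℝ) (μ0 : Measure (EuclideanSpace ℝ (Fin d))) [IsProbabilityMeasure μ0]
    (hμ0Supp : μ0 Ωᶜ = 0)
    (hwarm : ∀ A : Set (EuclideanSpace ℝ (Fin d)), MeasurableSet A →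
      μ0 A ≤ ENNReal.ofReal lam * πs A)
    (K : ℕ) :
    ∀ A : Set (EuclideanSpace ℝ (Fin d)), MeasurableSet A →
      |((chainDist T μ0 K) A).toReal - (πs A).toReal| ≤
        lam * (1 - conductance Tstar Ω πs ^ 2 / 8) ^ K + 16 * δ / conductance Tstar Ω πs := by
  set φ := conductance Tstar Ω πs
  have hφ0 : 0 ≤ φ := conductance_nonneg
  have hδφ : δ ≤ φ / 16 := hδ.trans (min_le_right _ _)
  have hΩae : ∀ᵐ u ∂πs, u ∈ Ω := hπsSupp
  have lazy_real : ∀ S : Kernel (EuclideanSpace ℝ (Fin d)) (EuclideanSpace ℝ (Fin d)),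
      [IsMarkovKernel S] → (∀ u ∈ Ω, (2⁻¹ : ℝ≥0∞) ≤ S u {u}) →
      ∀ A : Set (EuclideanSpace ℝ (Fin d)), ∀ᵐ u ∂πs, u ∈ A → 1 / 2 ≤ (S u).real A := by
    intro S _ hS A
    filter_upwards [hΩae] with u hu huA
    have h1 : (2⁻¹ : ℝ≥0∞) ≤ S u A :=
      (hS u hu).trans (measure_mono (Set.singleton_subset_iff.2 huA))
    simpa [measureReal_def] using ENNReal.toReal_mono (measure_ne_top _ _) h1
  have hclose_real : ∀ B : Set (EuclideanSpace ℝ (Fin d)), MeasurableSet B →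
      ∀ᵐ u ∂πs, (1 - δ) * (Tstar u).real B ≤ (T u).real B ∧
        (T u).real B ≤ (1 + δ) * (Tstar u).real B := by
    intro B hB
    have hδ1 : 0 ≤ 1 - δ := by
      have := hδ.trans (min_le_left _ _)
      linarith [Real.sqrt_nonneg 2]
    filter_upwards [hΩae] with u hu
    obtain ⟨h1, h2⟩ := hclose u hu (B ∩ Ω) (hB.inter hΩ) Set.inter_subset_right
    rw [measure_inter_conull (hTSupp u hu), measure_inter_conull (hTstarSupp u hu)] at h1 h2
    constructor
    · simpa [measureReal_def, ENNReal.toReal_mul, ENNReal.toReal_ofReal hδ1] using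
        ENNReal.toReal_mono (measure_ne_top _ _) h1
    · simpa [measureReal_def, ENNReal.toReal_mul,
        ENNReal.toReal_ofReal (show 0 ≤ 1 + δ by linarith)] using
        ENNReal.toReal_mono (ENNReal.mul_ne_top ENNReal.ofReal_ne_top (measure_ne_top _ _)) h2
  have hsymm : ∀ A : Set (EuclideanSpace ℝ (Fin d)), MeasurableSet A →
      ∫ u in Aᶜ, (Tstar u).real A ∂πs = ∫ u in A, (Tstar u).real Aᶜ ∂πs := by
    intro A hA
    rw [setIntegral_kernel_real Tstar hA, setIntegral_kernel_real Tstar hA.compl,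
      hrev A Aᶜ hA hA.compl]
  have hflow : ∀ A, MeasurableSet A → 2 * ∫ u in A, (Tstar u).real Aᶜ ∂πs ≤ πs.real A ∧
      2 * ∫ u in A, (Tstar u).real Aᶜ ∂πs ≤ 1 - πs.real A := by
    intro A hA
    refine ⟨two_mul_setIntegral_kernel_compl_le Tstar hA (lazy_real Tstar hTstarLazy A), ?_⟩
    have := two_mul_setIntegral_kernel_compl_le Tstar hA.compl (lazy_real Tstar hTstarLazy Aᶜ)
    rwa [compl_compl, hsymm A hA, probReal_compl_eq_one_sub hA] at this
  have hφ1 : φ ≤ 1 / 2 := conductance_le_half hΩ hTstarSupp hπsSupp hflow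
  have hlam : 1 ≤ lam := by
    have := hwarm Set.univ MeasurableSet.univ
    simpa using this
  have hr : 0 ≤ 1 - φ ^ 2 / 8 := by nlinarith
  have hq : 0 ≤ 16 * δ / φ := by positivity
  have hqφ : 16 * δ / φ * φ = 16 * δ := by
    rcases hφ0.eq_or_lt with h | h
    · have : δ = 0 := by linarith
      simp [this]
    · field_simp
  have hprob := fun k => isProbabilityMeasure_chainDist (T := T) μ0 k
  have main : ∀ k, ∀ A, MeasurableSet A → (chainDist T μ0 k).real A ≤
      πs.real A + (lam * (1 - φ ^ 2 / 8) ^ k + 16 * δ / φ) * sqrtProfile (πs.real A) := by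
    intro k
    induction k with
    | zero =>
      intro A hA
      have h1 : μ0.real A ≤ lam * πs.real A := by
        have := ENNReal.toReal_mono
          (ENNReal.mul_ne_top ENNReal.ofReal_ne_top (measure_ne_top _ _)) (hwarm A hA)
        rwa [ENNReal.toReal_mul, ENNReal.toReal_ofReal (by linarith)] at this
      have h2 : μ0.real A ≤ 1 := measureReal_le_one
      have hx0 : 0 ≤ πs.real A := measureReal_nonneg
      have hx1 : πs.real A ≤ 1 := measureReal_le_one
      have h3 := mul_nonneg hq (sqrtProfile_nonneg (πs.real A))
      suffices h : μ0.real A ≤ πs.real A + lam * sqrtProfile (πs.real A) by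
        simp only [chainDist, pow_zero, mul_one, add_mul]
        linarith
      rcases min_choice (Real.sqrt (πs.real A)) (Real.sqrt (1 - πs.real A)) with h | h
      · have : πs.real A ≤ Real.sqrt (πs.real A) := Real.le_sqrt_of_sq_le (by nlinarith)
        rw [sqrtProfile, h]
        nlinarith
      · have : 1 - πs.real A ≤ Real.sqrt (1 - πs.real A) := Real.le_sqrt_of_sq_le (by nlinarith)
        rw [sqrtProfile, h]
        nlinarith
    | succ k ih =>
      intro A hA
      have := hprob k
      have hp : 0 ≤ lam * (1 - φ ^ 2 / 8) ^ k := mul_nonneg (by linarith) (pow_nonneg hr k)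
      have hlazy' : ∀ᵐ u ∂πs, u ∈ Aᶜ → (T u).real A ≤ 1 / 2 := by
        filter_upwards [lazy_real T hTLazy Aᶜ] with u hu huA
        have := hu huA
        rw [probReal_compl_eq_one_sub hA] at this
        linarith
      refine (bind_real_le_of_lazy T (add_nonneg hp hq) ih hA (lazy_real T hTLazy A)
        hlazy').trans ?_
      obtain ⟨ha, ha'⟩ := setIntegral_kernel_close hA.compl (hclose_real Aᶜ hA.compl) A
      obtain ⟨hb, hb'⟩ := setIntegral_kernel_close hA (hclose_real A hA) Aᶜ
      rw [hsymm A hA] at hb hb'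
      have := sqrtProfile_contraction measureReal_nonneg measureReal_le_one
        (conductance_mul_min_le hΩ hTstarSupp hπsSupp hA) (hflow A hA).1 (hflow A hA).2
        ha ha' hb hb' hφ0 hδ0 hδφ hp hq hqφ
      rwa [mul_assoc, ← pow_succ] at this
  have upper : ∀ A, MeasurableSet A → (chainDist T μ0 K).real A - πs.real A ≤
      lam * (1 - φ ^ 2 / 8) ^ K + 16 * δ / φ := by
    intro A hA
    have hc : 0 ≤ lam * (1 - φ ^ 2 / 8) ^ K + 16 * δ / φ :=
      add_nonneg (mul_nonneg (by linarith) (pow_nonneg hr K)) hq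
    have := mul_le_mul_of_nonneg_left
      (sqrtProfile_le_one (measureReal_le_one (μ := πs) (s := A))) hc
    linarith [main K A hA]
  intro A hA
  have := hprob K
  have h1 := upper A hA
  have h2 := upper Aᶜ hA.compl
  rw [probReal_compl_eq_one_sub hA, probReal_compl_eq_one_sub hA] at h2
  exact abs_le.2 ⟨by simp only [← measureReal_def]; linarith, h1⟩
end

section
/- Let f : ℝ^d → ℝ be continuously differentiable and (m,b)-dissipative, let x* be a global minimizer of f, and let β > 0. Then ∫_{ℝ^d} e^{−βf(y)} dy ≤ (4π/(mβ))^{d/2} · e^{−β(f(x*) − b/2)}. -/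
open scoped InnerProductSpace

/-- A dissipative differentiable function that is bounded below by `c` grows at least
quadratically: `c + m / 4 * ‖y‖ ^ 2 - b / 2 ≤ f y`. -/
theorem quadratic_lower_bound_of_dissipative {E : Type*} [NormedAddCommGroup E]
    [InnerProductSpace ℝ E] [CompleteSpace E] {f : E → ℝ} {m b c : ℝ} (hb : 0 ≤ b)
    (hf : Differentiable ℝ f) (hdiss : ∀ x, m * ‖x‖ ^ 2 - b ≤ ⟪gradient f x, x⟫_ℝ)
    (hmin : ∀ y, c ≤ f y) (y : E) : c + m / 4 * ‖y‖ ^ 2 - b / 2 ≤ f y := by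
  rcases le_or_gt (m * ‖y‖ ^ 2) (2 * b) with h | h
  · linarith [hmin y]
  have hN : 0 < m * ‖y‖ ^ 2 := by linarith
  set s := √(2 * b / (m * ‖y‖ ^ 2)) with hs
  have hs0 : 0 ≤ s := Real.sqrt_nonneg _
  have hs2 : s ^ 2 * (m * ‖y‖ ^ 2) = 2 * b := by
    rw [hs, Real.sq_sqrt (by positivity), div_mul_cancel₀ _ hN.ne']
  have hs1 : s ≤ 1 := by
    rw [hs, Real.sqrt_le_one, div_le_one hN]
    exact h.le
  have hderiv (t : ℝ) : HasDerivAt (fun t : ℝ => f (t • y) - m / 4 * ‖y‖ ^ 2 * t ^ 2)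
      (⟪gradient f (t • y), y⟫_ℝ - m / 4 * ‖y‖ ^ 2 * (2 * t)) t := by
    have h1 : HasDerivAt (fun t : ℝ => t • y) y t := by
      simpa using (hasDerivAt_id t).smul_const y
    have h2 := (hf (t • y)).hasGradientAt.hasFDerivAt.comp_hasDerivAt t h1
    have h3 := (hasDerivAt_pow 2 t).const_mul (m / 4 * ‖y‖ ^ 2)
    refine (h2.sub h3).congr_deriv ?_
    simp
  have hmono : MonotoneOn (fun t : ℝ => f (t • y) - m / 4 * ‖y‖ ^ 2 * t ^ 2) (Set.Icc s 1) := by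
    refine monotoneOn_of_deriv_nonneg (convex_Icc s 1)
      (fun t _ => (hderiv t).continuousAt.continuousWithinAt)
      (fun t _ => (hderiv t).differentiableAt.differentiableWithinAt) fun t ht => ?_
    rw [interior_Icc] at ht
    rw [(hderiv t).deriv]
    have ht0 : 0 < t := hs0.trans_lt ht.1
    have hst : s ^ 2 ≤ t ^ 2 := pow_le_pow_left₀ hs0 ht.1.le 2
    have hd := hdiss (t • y)
    rw [inner_smul_right, norm_smul, mul_pow, Real.norm_eq_abs, sq_abs] at hd
    refine (mul_nonneg_iff_of_pos_left ht0).1 ?_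
    nlinarith [mul_le_mul_of_nonneg_right hst hN.le]
  have hle := hmono (Set.left_mem_Icc.2 hs1) (Set.right_mem_Icc.2 hs1) hs1
  simp only [one_smul, one_pow, mul_one] at hle
  linarith [hmin (s • y)]

theorem statement12 {d : ℕ} (f : EuclideanSpace ℝ (Fin d) → ℝ) (m b βv : ℝ)
    (hm : 0 < m) (hb : 0 ≤ b) (hβ : 0 < βv) (hf : ContDiff ℝ 1 f)
    (hdiss : ∀ x : EuclideanSpace ℝ (Fin d), m * ‖x‖ ^ 2 - b ≤ ⟪gradient f x, x⟫_ℝ)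
    (xstar : EuclideanSpace ℝ (Fin d)) (hmin : ∀ y, f xstar ≤ f y) :
    ∫ y : EuclideanSpace ℝ (Fin d), Real.exp (-βv * f y) ≤
      (4 * Real.pi / (m * βv)) ^ ((d : ℝ) / 2) * Real.exp (-βv * (f xstar - b / 2)) := by
  have hc : 0 < m * βv / 4 := by positivity
  have hG := GaussianFourier.integral_rexp_neg_mul_sq_norm (V := EuclideanSpace ℝ (Fin d)) hc
  have hint : MeasureTheory.Integrable
      (fun y : EuclideanSpace ℝ (Fin d) => Real.exp (-(m * βv / 4) * ‖y‖ ^ 2)) := by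
    refine MeasureTheory.Integrable.of_integral_ne_zero ?_
    rw [hG]
    positivity
  calc ∫ y : EuclideanSpace ℝ (Fin d), Real.exp (-βv * f y)
      ≤ ∫ y : EuclideanSpace ℝ (Fin d),
          Real.exp (-(m * βv / 4) * ‖y‖ ^ 2) * Real.exp (-βv * (f xstar - b / 2)) := by
        refine MeasureTheory.integral_mono_of_nonneg (.of_forall fun y => (Real.exp_pos _).le)
          (hint.mul_const _) (.of_forall fun y => ?_)
        simp only [← Real.exp_add]
        refine Real.exp_le_exp.2 ?_
        have h := quadratic_lower_bound_of_dissipative hb (hf.differentiable one_ne_zero)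
          hdiss hmin y
        nlinarith [mul_le_mul_of_nonneg_left h hβ.le]
    _ = _ := by
        rw [MeasureTheory.integral_mul_const, hG, finrank_euclideanSpace_fin]
        congr 2
        field_simp
end

section
/- Let f be continuously differentiable, (m,b)-dissipative, and L-smooth, let x* be a global minimizer of f with ∇f(x*) = 0, let β > 0 and R > 0, and let Ω = B(0,R). Let μ₀ be the Gaussian measure N(0, (2βL)^{-1} I_d) and let π* be the probability measure on Ω with density proportional to e^{−βf(x)}·1{x ∈ Ω}. Then for every measurable A ⊆ Ω, μ₀(A) ≤ (4L/m)^{d/2} e^{β(L‖x*‖₂² + b/2)} · π*(A). -/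
open MeasureTheory
open scoped InnerProductSpace

section Calculus

variable {E : Type*} [NormedAddCommGroup E] [InnerProductSpace ℝ E] [CompleteSpace E]

/-- The chain rule for a differentiable function along a differentiable curve. -/
theorem HasDerivAt.comp_gradient {f : E → ℝ} (hf : Differentiable ℝ f) {c : ℝ → E} {c' : E}
    {t : ℝ} (hc : HasDerivAt c c' t) :
    HasDerivAt (fun s => f (c s)) ⟪gradient f (c t), c'⟫_ℝ t := by
  have h := (hf (c t)).hasGradientAt.hasFDerivAt.comp_hasDerivAt t hc
  simpa [Function.comp_def] using h

/-- The quadratic upper bound for a smooth function at a critical point. -/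
theorem le_add_sq_of_gradient_lipschitz {f : E → ℝ} (hf : Differentiable ℝ f) {L : ℝ}
    (hsmooth : ∀ x y : E, ‖gradient f x - gradient f y‖ ≤ L * ‖x - y‖)
    {x₀ : E} (hgrad : gradient f x₀ = 0) (x : E) :
    f x ≤ f x₀ + L / 2 * ‖x - x₀‖ ^ 2 := by
  set v := x - x₀ with hv
  have hd : ∀ t : ℝ, HasDerivAt (fun s : ℝ => f (x₀ + s • v) - L / 2 * ‖v‖ ^ 2 * s ^ 2)
      (⟪gradient f (x₀ + t • v), v⟫_ℝ - L / 2 * ‖v‖ ^ 2 * (2 * t)) t := by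
    intro t
    have hc : HasDerivAt (fun s : ℝ => x₀ + s • v) v t := by
      simpa using ((hasDerivAt_id t).smul_const v).const_add x₀
    have hq : HasDerivAt (fun s : ℝ => s ^ 2) (2 * t) t := by
      simpa using hasDerivAt_pow 2 t
    exact (HasDerivAt.comp_gradient hf hc).sub (hq.const_mul _)
  have hanti : AntitoneOn (fun s : ℝ => f (x₀ + s • v) - L / 2 * ‖v‖ ^ 2 * s ^ 2)
      (Set.Ici 0) := by
    refine antitoneOn_of_deriv_nonpos (convex_Ici 0)
      (fun t _ => (hd t).continuousAt.continuousWithinAt)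
      (fun t _ => (hd t).differentiableAt.differentiableWithinAt) fun t ht => ?_
    rw [interior_Ici, Set.mem_Ioi] at ht
    rw [(hd t).deriv]
    have h := hsmooth (x₀ + t • v) x₀
    rw [hgrad, sub_zero, add_sub_cancel_left, norm_smul, Real.norm_of_nonneg ht.le] at h
    nlinarith [real_inner_le_norm (gradient f (x₀ + t • v)) v,
      mul_le_mul_of_nonneg_right h (norm_nonneg v)]
  have h := hanti (Set.mem_Ici.2 le_rfl) (Set.mem_Ici.2 zero_le_one) zero_le_one
  simp only [one_smul, zero_smul, add_zero, hv, add_sub_cancel] at h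
  linarith

/-- A dissipative function grows quadratically above its global minimum. -/
theorem add_sq_le_of_dissipative {f : E → ℝ} (hf : Differentiable ℝ f) {m b : ℝ} (hm : 0 ≤ m)
    (hdiss : ∀ x : E, m * ‖x‖ ^ 2 - b ≤ ⟪gradient f x, x⟫_ℝ)
    {x₀ : E} (hmin : ∀ y, f x₀ ≤ f y) (x : E) :
    f x₀ + m / 4 * ‖x‖ ^ 2 - b / 2 ≤ f x := by
  have hd : ∀ t : ℝ, HasDerivAt
      (fun s : ℝ => f (Real.exp s • x) - m / 2 * ‖x‖ ^ 2 * Real.exp s ^ 2 + b * s)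
      (⟪gradient f (Real.exp t • x), Real.exp t • x⟫_ℝ
        - m / 2 * ‖x‖ ^ 2 * (2 * Real.exp t * Real.exp t) + b) t := by
    intro t
    have hc := (Real.hasDerivAt_exp t).smul_const x
    have hq : HasDerivAt (fun s : ℝ => Real.exp s ^ 2) (2 * Real.exp t * Real.exp t) t := by
      simpa using (Real.hasDerivAt_exp t).fun_pow 2
    have hl : HasDerivAt (fun s : ℝ => b * s) b t := by
      simpa using (hasDerivAt_id t).const_mul b
    exact ((HasDerivAt.comp_gradient hf hc).sub (hq.const_mul _)).add hl
  have hmono : Monotone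
      (fun s : ℝ => f (Real.exp s • x) - m / 2 * ‖x‖ ^ 2 * Real.exp s ^ 2 + b * s) := by
    refine monotone_of_deriv_nonneg (fun t => (hd t).differentiableAt) fun t => ?_
    rw [(hd t).deriv]
    have h := hdiss (Real.exp t • x)
    rw [norm_smul, Real.norm_of_nonneg (Real.exp_pos t).le] at h
    linarith
  have h := hmono (show (-1 / 2 : ℝ) ≤ 0 by norm_num)
  have hexp : Real.exp (-1 / 2) ^ 2 ≤ 1 / 2 := by
    rw [← Real.exp_nat_mul]
    norm_num [Real.exp_neg]
    rw [inv_le_comm₀ (Real.exp_pos 1) (by norm_num)]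
    linarith [Real.add_one_le_exp 1]
  simp only [Real.exp_zero, one_smul, one_pow, mul_one, mul_zero, add_zero] at h
  nlinarith [hmin (Real.exp (-1 / 2) • x),
    mul_le_mul_of_nonneg_left hexp (by positivity : 0 ≤ m / 2 * ‖x‖ ^ 2)]

end Calculus

/-- The partition function of a Gibbs density with a quadratically growing potential. -/
theorem setIntegral_exp_neg_le_gaussian {d : ℕ} {g : EuclideanSpace ℝ (Fin d) → ℝ} {a c : ℝ}
    (ha : 0 < a) (hg : ∀ x, a * ‖x‖ ^ 2 - c ≤ g x) (S : Set (EuclideanSpace ℝ (Fin d))) :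
    ∫ x in S, Real.exp (-g x) ≤ Real.exp c * (Real.pi / a) ^ ((d : ℝ) / 2) := by
  have hgauss : ∫ x : EuclideanSpace ℝ (Fin d), Real.exp (-a * ‖x‖ ^ 2)
      = (Real.pi / a) ^ ((d : ℝ) / 2) := by
    simpa using GaussianFourier.integral_rexp_neg_mul_sq_norm
      (V := EuclideanSpace ℝ (Fin d)) ha
  have hint : Integrable fun x : EuclideanSpace ℝ (Fin d) => Real.exp (-a * ‖x‖ ^ 2) :=
    Integrable.of_integral_ne_zero (by rw [hgauss]; positivity)
  calc ∫ x in S, Real.exp (-g x)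
      ≤ ∫ x in S, Real.exp c * Real.exp (-a * ‖x‖ ^ 2) := by
        refine integral_mono_of_nonneg (ae_of_all _ fun x => (Real.exp_pos _).le)
          (hint.const_mul _).integrableOn (ae_of_all _ fun x => ?_)
        change Real.exp (-g x) ≤ Real.exp c * Real.exp (-a * ‖x‖ ^ 2)
        rw [← Real.exp_add]
        exact Real.exp_le_exp.2 (by linarith [hg x])
    _ ≤ ∫ x, Real.exp c * Real.exp (-a * ‖x‖ ^ 2) :=
        setIntegral_le_integral (hint.const_mul _) (ae_of_all _ fun x => by positivity)
    _ = _ := by rw [integral_const_mul, hgauss]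

theorem statement13 {d : ℕ} (f : EuclideanSpace ℝ (Fin d) → ℝ) (m b L βv R : ℝ)
    (hm : 0 < m) (hb : 0 ≤ b) (hL : 0 < L) (hβ : 0 < βv) (hR : 0 < R)
    (hf : ContDiff ℝ 1 f)
    (hdiss : ∀ x : EuclideanSpace ℝ (Fin d), m * ‖x‖ ^ 2 - b ≤ ⟪gradient f x, x⟫_ℝ)
    (hsmooth : ∀ x y : EuclideanSpace ℝ (Fin d),
      ‖gradient f x - gradient f y‖ ≤ L * ‖x - y‖)
    (xstar : EuclideanSpace ℝ (Fin d)) (hmin : ∀ y, f xstar ≤ f y)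
    (hgrad : gradient f xstar = 0)
    (Ω : Set (EuclideanSpace ℝ (Fin d)))
    (hΩ : Ω = Metric.closedBall (0 : EuclideanSpace ℝ (Fin d)) R)
    (μ0 : Measure (EuclideanSpace ℝ (Fin d)))
    (hμ0 : μ0 = gaussMeasure 0 (2 * βv * L)⁻¹)
    (πstar : Measure (EuclideanSpace ℝ (Fin d)))
    (hπstar : πstar = volume.withDensity
      (Ω.indicator fun x =>
        ENNReal.ofReal (Real.exp (-βv * f x) / ∫ y in Ω, Real.exp (-βv * f y)))) :
    ∀ A : Set (EuclideanSpace ℝ (Fin d)), MeasurableSet A → A ⊆ Ω →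
      (μ0 A).toReal ≤
        (4 * L / m) ^ ((d : ℝ) / 2) * Real.exp (βv * (L * ‖xstar‖ ^ 2 + b / 2)) *
          (πstar A).toReal := by
  intro A hA hAΩ
  have hdf : Differentiable ℝ f := hf.differentiable (by norm_num)
  have hcont : Continuous fun x => Real.exp (-βv * f x) :=
    Real.continuous_exp.comp (continuous_const.mul hf.continuous)
  have hΩc : IsCompact Ω := hΩ ▸ isCompact_closedBall 0 R
  have hint : IntegrableOn (fun x => Real.exp (-βv * f x)) Ω :=
    hcont.continuousOn.integrableOn_compact hΩc
  set Z := ∫ y in Ω, Real.exp (-βv * f y) with hZ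
  have hZpos : 0 < Z := by
    have : NeZero (volume.restrict Ω) := by
      refine ⟨fun h => ?_⟩
      rw [Measure.restrict_eq_zero, hΩ] at h
      exact (Metric.measure_closedBall_pos volume _ hR).ne' h
    exact integral_exp_pos hint
  have hZle : Z ≤ Real.exp (-βv * f xstar + βv * b / 2)
      * (4 * Real.pi / (βv * m)) ^ ((d : ℝ) / 2) := by
    have h := setIntegral_exp_neg_le_gaussian (g := fun x => βv * f x)
      (a := βv * m / 4) (c := -βv * f xstar + βv * b / 2) (by positivity)
      (fun x => by
        nlinarith [mul_le_mul_of_nonneg_left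
          (add_sq_le_of_dissipative hdf hm.le hdiss hmin x) hβ.le]) Ω
    simp only [← neg_mul] at h
    convert h using 3
    field_simp
  set C := (4 * L / m) ^ ((d : ℝ) / 2) * Real.exp (βv * (L * ‖xstar‖ ^ 2 + b / 2)) with hC
  have hC0 : 0 ≤ C := by positivity
  have hdens : ∀ x, (2 * Real.pi * (2 * βv * L)⁻¹) ^ (-(d : ℝ) / 2)
      * Real.exp (-‖x - 0‖ ^ 2 / (2 * (2 * βv * L)⁻¹))
      ≤ C * (Real.exp (-βv * f x) / Z) := by
    intro x
    have hup : f x ≤ f xstar + L * ‖x‖ ^ 2 + L * ‖xstar‖ ^ 2 := by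
      have h := le_add_sq_of_gradient_lipschitz hdf hsmooth hgrad x
      have hp := parallelogram_law_with_norm ℝ x xstar
      nlinarith [mul_le_mul_of_nonneg_left
        (by nlinarith [sq_nonneg ‖x + xstar‖] :
          ‖x - xstar‖ ^ 2 ≤ 2 * ‖x‖ ^ 2 + 2 * ‖xstar‖ ^ 2) hL.le]
    have hconst : (2 * Real.pi * (2 * βv * L)⁻¹) ^ (-(d : ℝ) / 2)
        * (4 * Real.pi / (βv * m)) ^ ((d : ℝ) / 2) = (4 * L / m) ^ ((d : ℝ) / 2) := by
      rw [neg_div, Real.rpow_neg (by positivity), ← Real.inv_rpow (by positivity),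
        ← Real.mul_rpow (by positivity) (by positivity)]
      congr 1
      field_simp
    have hexp : Real.exp (-‖x - 0‖ ^ 2 / (2 * (2 * βv * L)⁻¹))
        * Real.exp (-βv * f xstar + βv * b / 2)
        ≤ Real.exp (βv * (L * ‖xstar‖ ^ 2 + b / 2)) * Real.exp (-βv * f x) := by
      rw [← Real.exp_add, ← Real.exp_add, Real.exp_le_exp]
      have : -‖x - 0‖ ^ 2 / (2 * (2 * βv * L)⁻¹) = -(βv * L * ‖x‖ ^ 2) := by
        rw [sub_zero]
        field_simp
      rw [this]
      nlinarith [mul_le_mul_of_nonneg_left hup hβ.le]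
    rw [← mul_div_assoc, le_div_iff₀ hZpos]
    refine (mul_le_mul_of_nonneg_left hZle (by positivity)).trans ?_
    calc _ = ((2 * Real.pi * (2 * βv * L)⁻¹) ^ (-(d : ℝ) / 2)
          * (4 * Real.pi / (βv * m)) ^ ((d : ℝ) / 2))
          * (Real.exp (-‖x - 0‖ ^ 2 / (2 * (2 * βv * L)⁻¹))
            * Real.exp (-βv * f xstar + βv * b / 2)) := by ring
      _ ≤ (4 * L / m) ^ ((d : ℝ) / 2)
          * (Real.exp (βv * (L * ‖xstar‖ ^ 2 + b / 2)) * Real.exp (-βv * f x)) := by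
        rw [hconst]
        exact mul_le_mul_of_nonneg_left hexp (by positivity)
      _ = _ := by rw [hC]; ring
  have hπA : πstar A = ∫⁻ x in A, ENNReal.ofReal (Real.exp (-βv * f x) / Z) := by
    rw [hπstar, withDensity_apply _ hA]
    exact setLIntegral_congr_fun hA fun x hx => Set.indicator_of_mem (hAΩ hx) _
  have hfin : πstar A ≠ ⊤ := by
    rw [hπA]
    exact ((hint.mono_set hAΩ).div_const Z).lintegral_lt_top.ne
  have hle : μ0 A ≤ ENNReal.ofReal C * πstar A := by
    rw [hπA, hμ0, gaussMeasure, withDensity_apply _ hA,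
      ← lintegral_const_mul' _ _ ENNReal.ofReal_ne_top]
    refine lintegral_mono fun x => ?_
    rw [← ENNReal.ofReal_mul hC0]
    exact ENNReal.ofReal_le_ofReal (hdens x)
  have h := ENNReal.toReal_mono (ENNReal.mul_ne_top ENNReal.ofReal_ne_top hfin) hle
  rwa [ENNReal.toReal_mul, ENNReal.toReal_ofReal hC0] at h
end

section
/- Let f be continuously differentiable, (m,b)-dissipative, and L-smooth with m ≤ 4L, let x* be a global minimizer of f with ∇f(x*) = 0, and let π be the probability measure on ℝ^d with density p(x) = e^{−βf(x)}/Z, Z = ∫ e^{−βf(y)} dy. Then for every x ∈ ℝ^d with ‖x‖₂² ≥ (4/m)(β^{-1} d log(4L/m) + b), one has p(x) ≤ (mβ/(8π))^{d/2} e^{−mβ‖x‖₂²/8}, i.e., the density of π at x is at most the density of the Gaussian N(0, (4/(mβ)) I_d) at x. -/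
open MeasureTheory
open scoped InnerProductSpace

section

variable {E : Type*} [NormedAddCommGroup E] [InnerProductSpace ℝ E] [CompleteSpace E]

/-- The derivative of a differentiable function along an affine line. -/
theorem hasDerivAt_comp_line_gradient {f : E → ℝ} (hf : Differentiable ℝ f) (a v : E) (t : ℝ) :
    HasDerivAt (fun s : ℝ => f (a + s • v)) ⟪gradient f (a + t • v), v⟫_ℝ t := by
  have h₁ := (hf (a + t • v)).hasGradientAt.hasFDerivAt
  have h₂ : HasDerivAt (fun s : ℝ => a + s • v) v t := by
    simpa using ((hasDerivAt_id t).smul_const v).const_add a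
  exact (h₁.comp_hasDerivAt t h₂).congr_deriv (by simp)

/-- The quadratic upper bound at a critical point of a smooth function. -/
theorem le_add_sq_dist_of_gradient_eq_zero {f : E → ℝ} {L : ℝ} (hf : Differentiable ℝ f)
    (hsmooth : ∀ x y : E, ‖gradient f x - gradient f y‖ ≤ L * ‖x - y‖)
    {a : E} (ha : gradient f a = 0) (y : E) : f y ≤ f a + L / 2 * ‖y - a‖ ^ 2 := by
  set v := y - a with hv
  have hd (t : ℝ) : HasDerivAt (fun s : ℝ => f (a + s • v) - L / 2 * ‖v‖ ^ 2 * s ^ 2)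
      (⟪gradient f (a + t • v), v⟫_ℝ - L * ‖v‖ ^ 2 * t) t := by
    refine ((hasDerivAt_comp_line_gradient hf a v t).sub
      ((hasDerivAt_pow 2 t).const_mul (L / 2 * ‖v‖ ^ 2))).congr_deriv ?_
    simp
    ring
  have hanti : AntitoneOn (fun s : ℝ => f (a + s • v) - L / 2 * ‖v‖ ^ 2 * s ^ 2)
      (Set.Icc 0 1) := by
    refine antitoneOn_of_deriv_nonpos (convex_Icc 0 1)
      (fun t _ => (hd t).continuousAt.continuousWithinAt)
      (fun t _ => (hd t).differentiableAt.differentiableWithinAt) fun t ht => ?_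
    rw [interior_Icc] at ht
    rw [(hd t).deriv, sub_nonpos]
    calc ⟪gradient f (a + t • v), v⟫_ℝ ≤ ‖gradient f (a + t • v)‖ * ‖v‖ := real_inner_le_norm _ _
      _ ≤ (L * ‖t • v‖) * ‖v‖ := by
        gcongr
        simpa [ha] using hsmooth (a + t • v) a
      _ = L * ‖v‖ ^ 2 * t := by
        rw [norm_smul, Real.norm_of_nonneg ht.1.le]
        ring
  have h := hanti (Set.left_mem_Icc.2 zero_le_one) (Set.right_mem_Icc.2 zero_le_one) zero_le_one
  simp [hv] at h
  linarith

/-- A dissipative function bounded below by `c` grows at least quadratically. -/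
theorem le_of_dissipative {f : E → ℝ} {m b c : ℝ} (hb : 0 ≤ b) (hf : Differentiable ℝ f)
    (hdiss : ∀ x : E, m * ‖x‖ ^ 2 - b ≤ ⟪gradient f x, x⟫_ℝ) (hc : ∀ y, c ≤ f y) (x : E) :
    c + m * ‖x‖ ^ 2 / 4 - b / 2 ≤ f x := by
  have hd (t : ℝ) (ht : 0 < t) :
      HasDerivAt (fun s : ℝ => f (0 + s • x) - m / 2 * ‖x‖ ^ 2 * s ^ 2 + b * Real.log s)
        (⟪gradient f (0 + t • x), x⟫_ℝ - m * ‖x‖ ^ 2 * t + b * t⁻¹) t := by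
    refine (((hasDerivAt_comp_line_gradient hf 0 x t).sub
      ((hasDerivAt_pow 2 t).const_mul (m / 2 * ‖x‖ ^ 2))).add
      ((Real.hasDerivAt_log ht.ne').const_mul b)).congr_deriv ?_
    simp
    ring
  set r : ℝ := √(1 / 2) with hr
  have hr0 : 0 < r := by positivity
  have hr2 : r ^ 2 = 1 / 2 := Real.sq_sqrt (by norm_num)
  have hr1 : r ≤ 1 := by nlinarith
  have hmono : MonotoneOn
      (fun s : ℝ => f (0 + s • x) - m / 2 * ‖x‖ ^ 2 * s ^ 2 + b * Real.log s) (Set.Icc r 1) := by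
    refine monotoneOn_of_deriv_nonneg (convex_Icc r 1)
      (fun t ht => (hd t (hr0.trans_le ht.1)).continuousAt.continuousWithinAt)
      (fun t ht => ?_) fun t ht => ?_
    all_goals rw [interior_Icc] at ht; have ht0 : 0 < t := hr0.trans ht.1
    · exact (hd t ht0).differentiableAt.differentiableWithinAt
    · rw [(hd t ht0).deriv]
      have h := hdiss (t • x)
      rw [norm_smul, Real.norm_of_nonneg ht0.le, inner_smul_right] at h
      have h₁ : 0 ≤ t * (⟪gradient f (t • x), x⟫_ℝ - m * ‖x‖ ^ 2 * t + b * t⁻¹) := by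
        have : t * t⁻¹ = 1 := mul_inv_cancel₀ ht0.ne'
        linear_combination h - b * this
      rw [zero_add]
      exact nonneg_of_mul_nonneg_right h₁ ht0
  have h := hmono (Set.left_mem_Icc.2 hr1) (Set.right_mem_Icc.2 hr1) hr1
  have hlog : -(1 / 2) ≤ Real.log r := by
    have h₁ : Real.log (r ^ 2) = 2 * Real.log r := by
      rw [Real.log_pow]
      norm_num
    rw [hr2, one_div, Real.log_inv] at h₁
    have h₂ := Real.log_two_lt_d9
    linarith
  simp only [zero_add, one_smul, hr2, Real.log_one] at h
  have := mul_le_mul_of_nonneg_left hlog hb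
  linarith [hc (r • x)]

end

section

variable {V : Type*} [NormedAddCommGroup V] [InnerProductSpace ℝ V] [FiniteDimensional ℝ V]
  [MeasurableSpace V] [BorelSpace V]

theorem integrable_exp_neg_mul_sq_norm {a : ℝ} (ha : 0 < a) :
    Integrable fun v : V => Real.exp (-a * ‖v‖ ^ 2) := by
  have h := (GaussianFourier.integrable_cexp_neg_mul_sq_norm_add (V := V) (b := (a : ℂ))
    (by simpa using ha) 0 0).norm
  simpa [Complex.norm_exp, ← Complex.ofReal_pow] using h

end

theorem statement14 {d : ℕ} (f : EuclideanSpace ℝ (Fin d) → ℝ) (m b L βv : ℝ)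
    (hm : 0 < m) (hb : 0 ≤ b) (hβ : 0 < βv) (hmL : m ≤ 4 * L) (hf : ContDiff ℝ 1 f)
    (hdiss : ∀ x : EuclideanSpace ℝ (Fin d), m * ‖x‖ ^ 2 - b ≤ ⟪gradient f x, x⟫_ℝ)
    (hsmooth : ∀ x y : EuclideanSpace ℝ (Fin d),
      ‖gradient f x - gradient f y‖ ≤ L * ‖x - y‖)
    (xstar : EuclideanSpace ℝ (Fin d)) (hmin : ∀ y, f xstar ≤ f y)
    (hgrad : gradient f xstar = 0)
    (Z : ℝ) (hZ : Z = ∫ y, Real.exp (-βv * f y))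
    (x : EuclideanSpace ℝ (Fin d))
    (hx : 4 / m * (βv⁻¹ * d * Real.log (4 * L / m) + b) ≤ ‖x‖ ^ 2) :
    Real.exp (-βv * f x) / Z ≤
      (m * βv / (8 * Real.pi)) ^ ((d : ℝ) / 2) * Real.exp (-m * βv * ‖x‖ ^ 2 / 8) := by
  have hL : 0 < L := by linarith
  have hdf : Differentiable ℝ f := hf.differentiable (by norm_num)
  have hlow := le_of_dissipative hb hdf hdiss hmin
  have hup := le_add_sq_dist_of_gradient_eq_zero hdf hsmooth hgrad
  have hint : Integrable fun y => Real.exp (-βv * f y) := by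
    refine ((integrable_exp_neg_mul_sq_norm (V := EuclideanSpace ℝ (Fin d))
      (show 0 < βv * m / 4 by positivity)).const_mul
        (Real.exp (-βv * (f xstar - b / 2)))).mono' ?_ (.of_forall fun y => ?_)
    · exact (Real.continuous_exp.comp (hf.continuous.const_mul _)).aestronglyMeasurable
    · rw [Real.norm_of_nonneg (Real.exp_pos _).le, ← Real.exp_add, Real.exp_le_exp]
      nlinarith [mul_le_mul_of_nonneg_left (hlow y) hβ.le]
  have hA : 0 < βv * L / 2 := by positivity
  have hZlow : Real.exp (-βv * f xstar) * (Real.pi / (βv * L / 2)) ^ ((d : ℝ) / 2) ≤ Z := by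
    have hG : ∫ y : EuclideanSpace ℝ (Fin d), Real.exp (-(βv * L / 2) * ‖y - xstar‖ ^ 2) =
        (Real.pi / (βv * L / 2)) ^ ((d : ℝ) / 2) := by
      rw [integral_sub_right_eq_self
        (fun y : EuclideanSpace ℝ (Fin d) => Real.exp (-(βv * L / 2) * ‖y‖ ^ 2)) xstar,
        GaussianFourier.integral_rexp_neg_mul_sq_norm hA, finrank_euclideanSpace_fin]
    rw [hZ, ← hG, ← integral_const_mul]
    refine integral_mono (((integrable_exp_neg_mul_sq_norm hA).comp_sub_right xstar).const_mul _)
      hint fun y => ?_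
    simp only
    rw [← Real.exp_add, Real.exp_le_exp]
    nlinarith [mul_le_mul_of_nonneg_left (hup y) hβ.le]
  have hZpos : 0 < Z := lt_of_lt_of_le (by positivity) hZlow
  rw [div_le_iff₀ hZpos]
  refine le_trans ?_ (mul_le_mul_of_nonneg_left hZlow (by positivity))
  have hprod : (m * βv / (8 * Real.pi)) ^ ((d : ℝ) / 2) *
      (Real.pi / (βv * L / 2)) ^ ((d : ℝ) / 2) = Real.exp (-(d / 2 * Real.log (4 * L / m))) := by
    rw [← Real.mul_rpow (by positivity) (by positivity),
      show m * βv / (8 * Real.pi) * (Real.pi / (βv * L / 2)) = (4 * L / m)⁻¹ by field_simp; norm_num,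
      Real.rpow_def_of_pos (by positivity), Real.log_inv]
    ring_nf
  calc Real.exp (-βv * f x)
      ≤ Real.exp (-(d / 2 * Real.log (4 * L / m)) + (-m * βv * ‖x‖ ^ 2 / 8 + -βv * f xstar)) := by
        rw [Real.exp_le_exp]
        have h₁ := mul_le_mul_of_nonneg_left hx (show 0 ≤ m * βv / 8 by positivity)
        have h₂ : m * βv / 8 * (4 / m * (βv⁻¹ * d * Real.log (4 * L / m) + b)) =
            d / 2 * Real.log (4 * L / m) + βv * b / 2 := by
          field_simp
          ring
        nlinarith [mul_le_mul_of_nonneg_left (hlow x) hβ.le]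
    _ = _ := by
        rw [Real.exp_add, Real.exp_add, ← hprod]
        ring
end

section
/- Assume each ∇f_i is L-Lipschitz with G = max_{i∈[n]} ‖∇f_i(0)‖₂. Let R > 0, β > 0, K ≥ 1, δ ∈ (0,1), let η satisfy 0 < η ≤ dβ^{-1}(LR+G)^{-2}, and set r = √(2ηd/β)·(2 + √(2 log(2K/δ)/d)). Then for every x ∈ ℝ^d with ‖x‖₂ ≤ R, every size-B subset I ⊆ {1,…,n}, and ε ∼ N(0, I_d), the probability that ‖−η g(x,I) + √(2η/β) ε‖₂ > r is at most δ/(2K). -/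
open MeasureTheory
open scoped InnerProductSpace BigOperators

theorem norm_stochGrad_le {d n : ℕ} (fi : Fin n → EuclideanSpace ℝ (Fin d) → ℝ)
    (x : EuclideanSpace ℝ (Fin d)) (I : Finset (Fin n)) {M : ℝ} (hM : 0 ≤ M)
    (h : ∀ i, ‖gradient (fi i) x‖ ≤ M) : ‖stochGrad fi I.card x I‖ ≤ M := by
  rw [stochGrad, norm_smul, norm_inv, Real.norm_natCast]
  have hsum : ‖∑ i ∈ I, gradient (fi i) x‖ ≤ I.card * M := by
    simpa using norm_sum_le_of_le I fun i _ => h i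
  exact inv_mul_le_of_le_mul₀ (Nat.cast_nonneg _) hM hsum

theorem lintegral_exp_neg_mul_sq_norm {d : ℕ} {b : ℝ} (hb : 0 < b) :
    ∫⁻ x : EuclideanSpace ℝ (Fin d), ENNReal.ofReal (Real.exp (-b * ‖x‖ ^ 2)) =
      ENNReal.ofReal ((Real.pi / b) ^ ((d : ℝ) / 2)) := by
  have h := GaussianFourier.integral_rexp_neg_mul_sq_norm (V := EuclideanSpace ℝ (Fin d)) hb
  rw [finrank_euclideanSpace_fin] at h
  rw [← h, ofReal_integral_eq_lintegral_ofReal]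
  · refine Integrable.of_integral_ne_zero ?_
    rw [h]
    positivity
  · exact Filter.Eventually.of_forall fun x => (Real.exp_pos _).le

/-- Chernoff bound for the norm of a standard Gaussian vector. -/
theorem gaussMeasure_norm_gt_le {d : ℕ} {a : ℝ} (ha : 0 ≤ a) :
    gaussMeasure (0 : EuclideanSpace ℝ (Fin d)) 1 {e | √d * (1 + a) < ‖e‖} ≤
      ENNReal.ofReal (Real.exp (-(d * a ^ 2 / 2))) := by
  have ha1 : 0 < 1 + a := by linarith
  set b : ℝ := 1 / (2 * (1 + a) ^ 2) with hb
  have hb0 : 0 < b := by positivity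
  have hb1 : b ≤ 1 / 2 := by
    rw [hb, div_le_div_iff₀ (by positivity) (by norm_num)]
    nlinarith
  have hbmul : b * (1 + a) ^ 2 = 1 / 2 := by rw [hb]; field_simp
  set c : ℝ := (2 * Real.pi) ^ (-(d : ℝ) / 2) * Real.exp (-(d / 2 * ((1 + a) ^ 2 - 1))) with hc
  have hc0 : 0 ≤ c := by positivity
  have hmeas : MeasurableSet {e : EuclideanSpace ℝ (Fin d) | √d * (1 + a) < ‖e‖} :=
    measurableSet_lt measurable_const measurable_norm
  rw [gaussMeasure, withDensity_apply _ hmeas]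
  calc
    _ ≤ ∫⁻ x in {e : EuclideanSpace ℝ (Fin d) | √d * (1 + a) < ‖e‖},
          ENNReal.ofReal c * ENNReal.ofReal (Real.exp (-b * ‖x‖ ^ 2)) := by
      refine setLIntegral_mono' hmeas fun x hx => ?_
      have hsq : d * (1 + a) ^ 2 ≤ ‖x‖ ^ 2 := by
        have hx' : √d * (1 + a) < ‖x‖ := hx
        have h := pow_le_pow_left₀ (by positivity) hx'.le 2
        rwa [mul_pow, Real.sq_sqrt (Nat.cast_nonneg d)] at h
      rw [← ENNReal.ofReal_mul hc0, hc, mul_assoc _ (Real.exp _), ← Real.exp_add, sub_zero,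
        mul_one, mul_one]
      refine ENNReal.ofReal_le_ofReal ?_
      gcongr
      have h := mul_le_mul_of_nonneg_left hsq (sub_nonneg.2 hb1)
      have : (1 / 2 - b) * (d * (1 + a) ^ 2) = d / 2 * ((1 + a) ^ 2 - 1) := by
        linear_combination -(d : ℝ) * hbmul
      linarith
    _ ≤ ∫⁻ x : EuclideanSpace ℝ (Fin d),
          ENNReal.ofReal c * ENNReal.ofReal (Real.exp (-b * ‖x‖ ^ 2)) :=
      setLIntegral_le_lintegral _ _
    _ = ENNReal.ofReal (c * (Real.pi / b) ^ ((d : ℝ) / 2)) := by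
      rw [lintegral_const_mul' _ _ ENNReal.ofReal_ne_top, lintegral_exp_neg_mul_sq_norm hb0,
        ENNReal.ofReal_mul hc0]
    _ ≤ _ := by
      refine ENNReal.ofReal_le_ofReal ?_
      have hpi : Real.pi / b = 2 * Real.pi * (1 + a) ^ 2 := by rw [hb]; field_simp
      have hpow : ((1 + a) ^ 2) ^ ((d : ℝ) / 2) = (1 + a) ^ d := by
        rw [← Real.rpow_natCast_mul ha1.le, Nat.cast_ofNat, mul_div_cancel₀ _ two_ne_zero,
          Real.rpow_natCast]
      have hcancel : (2 * Real.pi) ^ (-(d : ℝ) / 2) * (2 * Real.pi) ^ ((d : ℝ) / 2) = 1 := by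
        rw [← Real.rpow_add (by positivity), neg_div, neg_add_cancel, Real.rpow_zero]
      have hexp : (1 + a) ^ d ≤ Real.exp (d * a) := by
        rw [Real.exp_nat_mul]
        gcongr
        linarith [Real.add_one_le_exp a]
      rw [hpi, Real.mul_rpow (by positivity) (by positivity), hpow, hc]
      calc
        _ = Real.exp (-(d / 2 * ((1 + a) ^ 2 - 1))) * (1 + a) ^ d := by
          linear_combination Real.exp (-(d / 2 * ((1 + a) ^ 2 - 1))) * (1 + a) ^ d * hcancel
        _ ≤ Real.exp (-(d / 2 * ((1 + a) ^ 2 - 1))) * Real.exp (d * a) := by gcongr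
        _ = _ := by rw [← Real.exp_add]; congr 1; ring

theorem statement17 {d n : ℕ} (hn : 0 < n)
    (fi : Fin n → EuclideanSpace ℝ (Fin d) → ℝ)
    (L G : ℝ)
    (hC1 : ∀ i, ContDiff ℝ 1 (fi i))
    (hLip : ∀ i, ∀ x y : EuclideanSpace ℝ (Fin d),
      ‖gradient (fi i) x - gradient (fi i) y‖ ≤ L * ‖x - y‖)
    (hG : G = Finset.sup' Finset.univ (Finset.univ_nonempty_iff.mpr ⟨⟨0, hn⟩⟩)
      (fun i => ‖gradient (fi i) (0 : EuclideanSpace ℝ (Fin d))‖))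
    (R βv δ η r : ℝ) (hR : 0 < R) (hβ : 0 < βv) (K : ℕ) (hK : 1 ≤ K)
    (hδ : δ ∈ Set.Ioo (0 : ℝ) 1)
    (hη0 : 0 < η) (hη : η ≤ d * βv⁻¹ * (L * R + G)⁻¹ ^ 2)
    (hr : r = Real.sqrt (2 * η * d / βv) * (2 + Real.sqrt (2 * Real.log (2 * K / δ) / d)))
    (x : EuclideanSpace ℝ (Fin d)) (hx : ‖x‖ ≤ R)
    (B : ℕ) (I : Finset (Fin n)) (hI : I.card = B) :
    gaussMeasure (0 : EuclideanSpace ℝ (Fin d)) 1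
        {e | r < ‖-(η • stochGrad fi B x I) + Real.sqrt (2 * η / βv) • e‖} ≤
      ENNReal.ofReal (δ / (2 * K)) := by
  obtain ⟨hδ0, hδ1⟩ := hδ
  have hd : d ≠ 0 := by
    rintro rfl
    simp at hη
    linarith
  have hd0 : (0 : ℝ) < d := by exact_mod_cast Nat.pos_of_ne_zero hd
  have hgrad0 (i) : ‖gradient (fi i) 0‖ ≤ G := by
    rw [hG]
    exact Finset.le_sup' (fun i => ‖gradient (fi i) (0 : EuclideanSpace ℝ (Fin d))‖)
      (Finset.mem_univ i)
  have hL : 0 ≤ L := by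
    have h := (norm_nonneg _).trans (hLip ⟨0, hn⟩ (EuclideanSpace.single ⟨0, by omega⟩ 1) 0)
    simpa using h
  set M := L * R + G with hM
  have hM0 : 0 ≤ M := add_nonneg (by positivity) ((norm_nonneg _).trans (hgrad0 ⟨0, hn⟩))
  have hMpos : 0 < M := by
    refine hM0.lt_of_ne' fun h => ?_
    simp [h] at hη
    linarith
  have hgrad (i) : ‖gradient (fi i) x‖ ≤ M := by
    have h1 := hLip i x 0
    rw [sub_zero] at h1
    have h2 := norm_le_norm_add_norm_sub' (gradient (fi i) x) (gradient (fi i) 0)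
    have h3 := mul_le_mul_of_nonneg_left hx hL
    linarith [hgrad0 i]
  have hdrift : ‖η • stochGrad fi B x I‖ ≤ √(2 * η * d / βv) := by
    subst hI
    have h1 : ‖η • stochGrad fi I.card x I‖ ≤ η * M := by
      rw [norm_smul, Real.norm_of_nonneg hη0.le]
      gcongr
      exact norm_stochGrad_le fi x I hM0 hgrad
    refine h1.trans (Real.le_sqrt_of_sq_le ?_)
    have h2 : η * M ^ 2 ≤ d / βv := by
      calc η * M ^ 2 ≤ d * βv⁻¹ * M⁻¹ ^ 2 * M ^ 2 := by gcongr
        _ = d / βv := by field_simp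
    calc (η * M) ^ 2 = η * (η * M ^ 2) := by ring
      _ ≤ η * (d / βv) := by gcongr
      _ ≤ 2 * (η * (d / βv)) := by linarith [show 0 ≤ η * (d / βv) by positivity]
      _ = 2 * η * d / βv := by ring
  have hK0 : (1 : ℝ) ≤ K := by exact_mod_cast hK
  have hlog : 0 ≤ Real.log (2 * K / δ) := by
    refine Real.log_nonneg ?_
    rw [le_div_iff₀ hδ0]
    linarith
  set a := √(2 * Real.log (2 * K / δ) / d) with ha
  have hs : 0 < √(2 * η / βv) := by positivity
  have hscale : √(2 * η * d / βv) = √(2 * η / βv) * √d := by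
    rw [← Real.sqrt_mul (by positivity)]
    congr 1
    ring
  have hsub : {e | r < ‖-(η • stochGrad fi B x I) + √(2 * η / βv) • e‖} ⊆
      {e : EuclideanSpace ℝ (Fin d) | √d * (1 + a) < ‖e‖} := by
    intro e he
    have h1 := norm_add_le (-(η • stochGrad fi B x I)) (√(2 * η / βv) • e)
    rw [norm_neg, norm_smul √(2 * η / βv), Real.norm_of_nonneg hs.le] at h1
    have h2 : r < ‖-(η • stochGrad fi B x I) + √(2 * η / βv) • e‖ := he
    rw [hr, hscale] at h2
    rw [hscale] at hdrift
    refine lt_of_mul_lt_mul_left ?_ hs.le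
    linarith
  refine (measure_mono hsub).trans ((gaussMeasure_norm_gt_le (Real.sqrt_nonneg _)).trans ?_)
  refine ENNReal.ofReal_le_ofReal (le_of_eq ?_)
  have hexp : d * a ^ 2 / 2 = Real.log (2 * K / δ) := by
    rw [ha, Real.sq_sqrt (by positivity)]
    field_simp
  rw [hexp, Real.exp_neg, Real.exp_log (by positivity), inv_div]
end
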